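/- Stability of function values for RMSProp: E[sup_{n≥1} g(θ_n)] < +∞. -/

import Mathlib

open MeasureTheory Filter

/-- If `y 0 = 0`, the square of the running maximum is controlled by the current value and the
discrete integral of the running maximum against the increments. -/
lemma sq_partialSups_le {y : ℕ → ℝ} (hy0 : y 0 = 0) (n : ℕ) :
    partialSups y n ^ 2 ≤
      4 * y n ^ 2 - 4 * ∑ k ∈ Finset.range n, partialSups y k * (y (k + 1) - y k) := by
  have key : ∑ k ∈ Finset.range n, partialSups y k * (y (k + 1) - y k)
      ≤ partialSups y n * y n - partialSups y n ^ 2 / 2 := by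
    induction n with
    | zero => simp [hy0]
    | succ n ih =>
      rw [Finset.sum_range_succ, partialSups_add_one]
      rcases le_total (y (n + 1)) (partialSups y n) with h | h
      · rw [sup_eq_left.2 h]; nlinarith
      · rw [sup_eq_right.2 h]
        nlinarith [sq_nonneg (y (n + 1) - partialSups y n)]
  nlinarith [sq_nonneg (partialSups y n - 2 * y n)]

section Doob

variable {Ω : Type*} {m0 : MeasurableSpace Ω} {P : Measure Ω}

lemma integral_mul_eq_zero_of_condExp_eq_zero [IsProbabilityMeasure P] {m : MeasurableSpace Ω}
    (hm : m ≤ m0) {h ζ : Ω → ℝ}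
    (hh : StronglyMeasurable[m] h) (hh2 : MemLp h 2 P) (hζ : MemLp ζ 2 P)
    (hc : P[ζ | m] =ᵐ[P] 0) : ∫ ω, h ω * ζ ω ∂P = 0 := by
  have hi : Integrable (h * ζ) P := hh2.integrable_mul hζ
  have := condExp_mul_of_stronglyMeasurable_left hh hi (hζ.integrable one_le_two)
  calc ∫ ω, h ω * ζ ω ∂P = ∫ ω, (P[h * ζ | m]) ω ∂P := (integral_condExp hm).symm
    _ = ∫ ω, (0 : ℝ) ∂P := by
        refine integral_congr_ae ?_
        filter_upwards [this, hc] with ω h1 h2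
        simp [h1, h2]
    _ = 0 := by simp

lemma memLp_partialSups_abs {p : ENNReal} {f : ℕ → Ω → ℝ} (hf : ∀ n, MemLp (f n) p P) (n : ℕ) :
    MemLp (fun ω => partialSups (fun k => |f k ω|) n) p P := by
  induction n with
  | zero =>
    simp only [partialSups_zero]
    exact (hf 0).abs
  | succ n ih =>
    simp_rw [partialSups_add_one]
    exact ih.sup (hf (n + 1)).abs

/-- Doob's `L²` maximal inequality for sums of martingale differences. -/
theorem lintegral_iSup_sq_sum_le [IsProbabilityMeasure P] (H : Filtration ℕ m0) {ζ : ℕ → Ω → ℝ}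
    (hmeas : ∀ k, StronglyMeasurable[H (k + 1)] (ζ k)) (hL2 : ∀ k, MemLp (ζ k) 2 P)
    (hc : ∀ k, P[ζ k | H k] =ᵐ[P] 0) {C : ℝ}
    (hC : ∀ n, ∑ k ∈ Finset.range n, ∫ ω, ζ k ω ^ 2 ∂P ≤ C) :
    ∫⁻ ω, ⨆ n, ENNReal.ofReal ((∑ k ∈ Finset.range n, ζ k ω) ^ 2) ∂P
      ≤ ENNReal.ofReal (4 * C) := by
  set N : ℕ → Ω → ℝ := fun n ω => ∑ k ∈ Finset.range n, ζ k ω with hN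
  have hN2 : ∀ n, MemLp (N n) 2 P := fun n => memLp_finsetSum _ fun k _ => hL2 k
  have hNm : ∀ n, StronglyMeasurable[H n] (N n) := fun n =>
    Finset.stronglyMeasurable_fun_sum _ fun k hk =>
      (hmeas k).mono (H.mono (Finset.mem_range.1 hk))
  set M : ℕ → Ω → ℝ := fun n ω => partialSups (fun k => |N k ω|) n with hM
  have hM2 : ∀ n, MemLp (M n) 2 P := memLp_partialSups_abs hN2
  have hMm : ∀ n, StronglyMeasurable[H n] (M n) := by
    intro n
    induction n with
    | zero => simpa [hM] using (hNm 0).norm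
    | succ n ih =>
      have : M (n + 1) = M n ⊔ fun ω => |N (n + 1) ω| := by
        ext ω; simp [hM, partialSups_add_one]
      rw [this]
      have h1 : StronglyMeasurable[H (n + 1)] (M n) := ih.mono (H.mono n.le_succ)
      have h2 : StronglyMeasurable[H (n + 1)] fun ω => |N (n + 1) ω| := (hNm (n + 1)).norm
      exact @StronglyMeasurable.sup _ _ _ _ (H (n + 1)) _ _ _ h1 h2
  have hM0 : ∀ n ω, 0 ≤ M n ω := fun n ω =>
    (abs_nonneg (N 0 ω)).trans (le_partialSups_of_le (fun k => |N k ω|) (Nat.zero_le n))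
  have hNsq : ∀ n, ∫ ω, N n ω ^ 2 ∂P ≤ C := by
    intro n
    refine le_trans (le_of_eq ?_) (hC n)
    induction n with
    | zero => simp [hN]
    | succ n ih =>
      rw [Finset.sum_range_succ, ← ih]
      have e : ∀ ω, N (n + 1) ω ^ 2 = N n ω ^ 2 + ζ n ω ^ 2 + 2 * (N n ω * ζ n ω) := by
        intro ω; simp only [hN, Finset.sum_range_succ]; ring
      simp_rw [e]
      have i1 := (hN2 n).integrable_sq
      have i2 := (hL2 n).integrable_sq
      have i3 : Integrable (fun ω => N n ω * ζ n ω) P := (hN2 n).integrable_mul (hL2 n)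
      have i12 : Integrable (fun ω => N n ω ^ 2 + ζ n ω ^ 2) P := i1.add i2
      rw [integral_add i12 (i3.const_mul 2), integral_add i1 i2, integral_const_mul,
        integral_mul_eq_zero_of_condExp_eq_zero (H.le n) (hNm n) (hN2 n) (hL2 n) (hc n)]
      ring
  have hMsq : ∀ n, ∫ ω, M n ω ^ 2 ∂P ≤ 4 * C := by
    intro n
    set s : ℕ → Ω → ℝ := fun k ω => if 0 ≤ N k ω then M k ω else - M k ω with hs
    have hsm : ∀ k, StronglyMeasurable[H k] (s k) := fun k =>
      StronglyMeasurable.ite (measurableSet_le measurable_const (hNm k).measurable)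
        (hMm k) (hMm k).neg
    have hs2 : ∀ k, MemLp (s k) 2 P := fun k =>
      (hM2 k).of_le ((hsm k).mono (H.le k)).aestronglyMeasurable
        (ae_of_all _ fun ω => by simp only [hs]; split_ifs <;> simp)
    have hpt : ∀ ω, M n ω ^ 2 ≤
        4 * N n ω ^ 2 - 4 * ∑ k ∈ Finset.range n, s k ω * ζ k ω := by
      intro ω
      have h1 := sq_partialSups_le (y := fun k => |N k ω|) (by simp [hN]) n
      rw [sq_abs] at h1
      refine h1.trans ?_
      refine sub_le_sub_left (mul_le_mul_of_nonneg_left (Finset.sum_le_sum fun k _ => ?_)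
        (by norm_num)) _
      have h2 : N (k + 1) ω = N k ω + ζ k ω := by simp [hN, Finset.sum_range_succ]
      have h3 := hM0 k ω
      have h4 : s k ω * ζ k ω ≤ M k ω * (|N (k + 1) ω| - |N k ω|) := by
        simp only [hs]
        split_ifs with h
        · rw [abs_of_nonneg h]
          nlinarith [le_abs_self (N (k + 1) ω)]
        · rw [abs_of_neg (not_le.1 h)]
          nlinarith [neg_le_abs (N (k + 1) ω)]
      exact h4
    have i1 := (hN2 n).integrable_sq
    have i2 : ∀ k, Integrable (fun ω => s k ω * ζ k ω) P := fun k => (hs2 k).integrable_mul (hL2 k)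
    have i3 : Integrable (fun ω => ∑ k ∈ Finset.range n, s k ω * ζ k ω) P :=
      integrable_finsetSum _ fun k _ => i2 k
    calc ∫ ω, M n ω ^ 2 ∂P
        ≤ ∫ ω, (4 * N n ω ^ 2 - 4 * ∑ k ∈ Finset.range n, s k ω * ζ k ω) ∂P :=
          integral_mono (hM2 n).integrable_sq ((i1.const_mul 4).sub (i3.const_mul 4)) hpt
      _ = 4 * ∫ ω, N n ω ^ 2 ∂P := by
          rw [integral_sub (i1.const_mul 4) (i3.const_mul 4), integral_const_mul,
            integral_const_mul, integral_finsetSum _ fun k _ => i2 k,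
            Finset.sum_eq_zero fun k _ => integral_mul_eq_zero_of_condExp_eq_zero (H.le k) (hsm k)
              (hs2 k) (hL2 k) (hc k)]
          ring
      _ ≤ 4 * C := by linarith [hNsq n]
  calc ∫⁻ ω, ⨆ n, ENNReal.ofReal (N n ω ^ 2) ∂P
      ≤ ∫⁻ ω, ⨆ n, ENNReal.ofReal (M n ω ^ 2) ∂P := by
        refine lintegral_mono fun ω => iSup_mono fun n => ENNReal.ofReal_le_ofReal ?_
        rw [← sq_abs]
        exact pow_le_pow_left₀ (abs_nonneg _) (le_partialSups (fun k => |N k ω|) n) 2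
    _ = ⨆ n, ∫⁻ ω, ENNReal.ofReal (M n ω ^ 2) ∂P := by
        refine lintegral_iSup (fun n => ?_) fun a b hab ω => ENNReal.ofReal_le_ofReal ?_
        · exact (((hMm n).mono (H.le n)).measurable.pow_const 2).ennreal_ofReal
        · exact pow_le_pow_left₀ (hM0 a ω) ((partialSups (fun k => |N k ω|)).mono hab) 2
    _ ≤ ENNReal.ofReal (4 * C) := by
        refine iSup_le fun n => ?_
        rw [← ofReal_integral_eq_lintegral_ofReal (hM2 n).integrable_sq
          (ae_of_all _ fun ω => sq_nonneg _)]
        exact ENNReal.ofReal_le_ofReal (hMsq n)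

end Doob

section Deterministic

/-- Drift bound for the potential `|x| + K |D| p` along one adaptive step, away from the
critical region. -/
lemma potential_increment_le {x G p p' D D' K L : ℝ} (hx : 1 ≤ |x|) (hD : 0 < |D|)
    (hxD : 0 ≤ x * D) (hp' : 0 < p') (hpp : p' ≤ p) (hG : |G| * p' ≤ 1)
    (hD' : |D'| ≤ |D| + L * (|G| * p')) (hK : 1 ≤ K) (hL : 0 ≤ L) :
    |x - p' * G| + K * |D'| * p' - (|x| + K * |D| * p) ≤
      -(D / |D| * p) * G + ((p / (4 * K) + K * L * p ^ 2 / 2) / |D|) * G ^ 2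
        + K * L * |D| * p ^ 2 / 2 := by
  have hs : |(D / |D|)| = 1 := by rw [abs_div, abs_abs, div_self hD.ne']
  have hsx : D / |D| * x = |x| := by
    rw [div_mul_eq_mul_div, div_eq_iff hD.ne', ← abs_mul, abs_of_nonneg hxD, mul_comm]
  set s := D / |D| with hs_def
  have hsG : |s * G| = |G| := by rw [abs_mul, hs, one_mul]
  have e1 : |x - p' * G| = |x| - p' * (s * G) := by
    have h1 : |x - p' * G| = |s * (x - p' * G)| := by rw [abs_mul, hs, one_mul]
    rw [h1, show s * (x - p' * G) = |x| - p' * (s * G) by rw [← hsx]; ring, abs_of_nonneg]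
    have := le_abs_self (s * G)
    rw [hsG] at this
    nlinarith
  have hp : 0 < p := hp'.trans_le hpp
  have hK0 : 0 < K := by linarith
  have h2 : -(p' * (s * G)) ≤ -(p * (s * G)) + |G| * (p - p') := by
    have := le_abs_self (s * G)
    rw [hsG] at this
    nlinarith
  have h3 : K * |D'| * p' ≤ K * |D| * p' + K * L * |G| * p ^ 2 := by
    have h4 : K * |D'| * p' ≤ K * (|D| + L * (|G| * p')) * p' := by gcongr
    have h5 : p' ^ 2 ≤ p ^ 2 := pow_le_pow_left₀ hp'.le hpp 2
    have h6 : 0 ≤ K * L * |G| := by positivity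
    nlinarith
  have h7 : |G| ≤ K * |D| + G ^ 2 / (4 * K * |D|) := by
    rw [← sub_le_iff_le_add', le_div_iff₀ (by positivity)]
    nlinarith [sq_nonneg (2 * K * |D| - |G|), sq_abs G]
  have h8 : |G| ≤ (|D| + G ^ 2 / |D|) / 2 := by
    have : |G| * |D| ≤ (|D| * |D| + G ^ 2) / 2 := by
      nlinarith [sq_nonneg (|D| - |G|), sq_abs G]
    have h9 : (|D| + G ^ 2 / |D|) / 2 = ((|D| * |D| + G ^ 2) / 2) / |D| := by field_simp
    rw [h9, le_div_iff₀ hD]; exact this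
  have h10 : (|G| - K * |D|) * (p - p') ≤ G ^ 2 / (4 * K * |D|) * p := by
    have h11 : 0 ≤ G ^ 2 / (4 * K * |D|) := by positivity
    nlinarith
  have h12 : K * L * |G| * p ^ 2 ≤ K * L * ((|D| + G ^ 2 / |D|) / 2) * p ^ 2 := by gcongr
  have e2 : ((p / (4 * K) + K * L * p ^ 2 / 2) / |D|) * G ^ 2 + K * L * |D| * p ^ 2 / 2
      = G ^ 2 / (4 * K * |D|) * p + K * L * ((|D| + G ^ 2 / |D|) / 2) * p ^ 2 := by
    field_simp
    ring
  rw [e1, add_assoc, e2]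
  nlinarith

lemma potential_le_add {x G p p' D D' K L : ℝ} (hp' : 0 < p') (hpp : p' ≤ p)
    (hD' : |D'| ≤ |D| + L * (|G| * p')) (hK : 1 ≤ K) (hL : 0 ≤ L) (hKL : K * L * p ≤ 1) :
    |x - p' * G| + K * |D'| * p' ≤ |x| + K * |D| * p + 2 * (|G| * p') := by
  have h1 : |x - p' * G| ≤ |x| + |G| * p' := by
    refine (abs_sub _ _).trans ?_
    rw [abs_mul, abs_of_pos hp', mul_comm]
  have h4 : K * |D'| * p' ≤ K * (|D| + L * (|G| * p')) * p' := by gcongr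
  have h5 : K * L * p' ≤ 1 := le_trans (by gcongr) hKL
  have h6 : 0 ≤ |G| * p' := by positivity
  have h7 : K * |D| * p' ≤ K * |D| * p := by gcongr
  nlinarith

lemma sq_potential_increment_le {x G p p' D D' K L : ℝ} (hp' : 0 < p') (hpp : p' ≤ p)
    (hD' : |D' - D| ≤ L * (|G| * p')) (hK : 1 ≤ K) (hL : 0 ≤ L) (hKL : K * L * p ≤ 1) :
    (|x - p' * G| + K * |D'| * p' - (|x| + K * |D| * p)) ^ 2 ≤
      8 * p ^ 2 * G ^ 2 + 2 * K ^ 2 * D ^ 2 * p ^ 2 := by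
  have h5 : K * L * p' ≤ 1 := le_trans (by gcongr) hKL
  have h6 : 0 ≤ |G| * p' := by positivity
  have h9 : |G| * p' ≤ |G| * p := by gcongr
  have hd := (abs_abs_sub_abs_le_abs_sub D' D).trans hD'
  rw [abs_le] at hd
  have hx : |(|x - p' * G| - |x|)| ≤ |G| * p' := by
    refine (abs_abs_sub_abs_le_abs_sub _ _).trans ?_
    rw [sub_sub_cancel_left, abs_neg, abs_mul, abs_of_pos hp', mul_comm]
  rw [abs_le] at hx
  have h8 : 0 ≤ K * |D| * (p - p') :=
    mul_nonneg (by positivity) (by linarith)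
  have h10 : 0 ≤ K * |D| * p' := by positivity
  have hKp : 0 ≤ K * p' := by positivity
  have key : |(|x - p' * G| + K * |D'| * p' - (|x| + K * |D| * p))|
      ≤ 2 * (|G| * p) + K * |D| * p := by
    have hu := mul_le_mul_of_nonneg_left hd.2 hKp
    have hl := mul_le_mul_of_nonneg_left hd.1 hKp
    have hm : K * p' * (L * (|G| * p')) ≤ |G| * p' := by nlinarith
    rw [abs_le]
    constructor <;> nlinarith
  rw [← sq_abs]
  calc |(|x - p' * G| + K * |D'| * p' - (|x| + K * |D| * p))| ^ 2
      ≤ (2 * (|G| * p) + K * |D| * p) ^ 2 := by gcongr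
    _ ≤ 2 * (2 * (|G| * p)) ^ 2 + 2 * (K * |D| * p) ^ 2 := by
        nlinarith [sq_nonneg (2 * (|G| * p) - K * |D| * p)]
    _ = 8 * p ^ 2 * |G| ^ 2 + 2 * K ^ 2 * |D| ^ 2 * p ^ 2 := by ring
    _ = _ := by rw [sq_abs, sq_abs]

end Deterministic

section Quadratic

variable {Ω : Type*} {m m0 : MeasurableSpace Ω} {P : Measure Ω}

/-- A conditional bound for a variable dominated by a quadratic polynomial in `G` with
`m`-measurable bounded coefficients. -/
lemma condExp_le_of_le_quadratic [IsProbabilityMeasure P] (hm : m ≤ m0)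
    {G Y α β γ d q : Ω → ℝ} (hG : MemLp G 2 P) (hY : Integrable Y P)
    (hα : StronglyMeasurable[m] α) (hβ : StronglyMeasurable[m] β) (hγ : StronglyMeasurable[m] γ)
    (hα' : ∃ C, ∀ ω, |α ω| ≤ C) (hβ' : ∃ C, ∀ ω, |β ω| ≤ C) (hγ' : ∃ C, ∀ ω, |γ ω| ≤ C)
    (hβ0 : ∀ ω, 0 ≤ β ω) (hle : ∀ ω, Y ω ≤ α ω * G ω + β ω * G ω ^ 2 + γ ω)
    (hd : P[G | m] =ᵐ[P] d) (hq : P[fun ω => G ω ^ 2 | m] ≤ᵐ[P] q) :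
    P[Y | m] ≤ᵐ[P] fun ω => α ω * d ω + β ω * q ω + γ ω := by
  obtain ⟨Cα, hCα⟩ := hα'
  obtain ⟨Cβ, hCβ⟩ := hβ'
  obtain ⟨Cγ, hCγ⟩ := hγ'
  have iG := hG.integrable one_le_two
  have iG2 := hG.integrable_sq
  have i1 : Integrable (α * G) P :=
    iG.bdd_mul (hα.mono hm).aestronglyMeasurable (ae_of_all _ hCα)
  have i2 : Integrable (β * fun ω => G ω ^ 2) P :=
    iG2.bdd_mul (hβ.mono hm).aestronglyMeasurable (ae_of_all _ hCβ)
  have i3 : Integrable γ P :=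
    Integrable.of_bound (hγ.mono hm).aestronglyMeasurable Cγ (ae_of_all _ hCγ)
  have h1 : P[Y | m] ≤ᵐ[P] P[α * G + (β * fun ω => G ω ^ 2) + γ | m] :=
    condExp_mono hY ((i1.add i2).add i3) (ae_of_all _ hle)
  filter_upwards [h1, condExp_add (i1.add i2) i3 m, condExp_add i1 i2 m,
    condExp_mul_of_stronglyMeasurable_left hα i1 iG,
    condExp_mul_of_stronglyMeasurable_left hβ i2 iG2, hd, hq] with ω h1 h2 h3 h4 h5 h6 h7
  rw [condExp_of_stronglyMeasurable hm hγ i3] at h2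
  simp only [Pi.add_apply, Pi.mul_apply] at h2 h3 h4 h5
  rw [h2, h3, h4, h5, h6] at h1
  have := mul_le_mul_of_nonneg_left h7 (hβ0 ω)
  linarith

end Quadratic

/-- A one-dimensional stochastic gradient process `x (k + 1) = x k - p (k + 1) * G k` with a
nonincreasing, random, adapted step size `p`, started once the step sizes are small. -/
structure AdaptiveStepRecursion {Ω : Type*} {m0 : MeasurableSpace Ω} (P : Measure Ω)
    (H : Filtration ℕ m0) (D : ℝ → ℝ) (L R δ σ₀ σ₁ K : ℝ) (b : ℕ → ℝ)
    (x p G : ℕ → Ω → ℝ) : Prop where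
  L_nonneg : 0 ≤ L
  one_le_R : 1 ≤ R
  δ_pos : 0 < δ
  σ₀_nonneg : 0 ≤ σ₀
  σ₁_nonneg : 0 ≤ σ₁
  one_le_K : 1 ≤ K
  noise_le : ∀ t, δ ≤ |t| → σ₀ * t ^ 2 + σ₁ ≤ K * t ^ 2
  lipschitz : ∀ s t, |D s - D t| ≤ L * |s - t|
  le_abs_of_le : ∀ t, R ≤ |t| → δ ≤ |D t|
  mul_nonneg_of_le : ∀ t, R ≤ |t| → 0 ≤ t * D t
  measurable_x : ∀ k, Measurable[H k] (x k)
  measurable_p : ∀ k, Measurable[H k] (p k)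
  memLp_G : ∀ k, MemLp (G k) 2 P
  bdd_zero : ∃ B, ∀ ω, |x 0 ω| ≤ B
  step : ∀ k ω, x (k + 1) ω = x k ω - p (k + 1) ω * G k ω
  p_pos : ∀ k ω, 0 < p k ω
  p_anti : ∀ k ω, p (k + 1) ω ≤ p k ω
  abs_step_le : ∀ k ω, |G k ω| * p (k + 1) ω ≤ 1
  p_small : ∀ k ω, 40 * K ^ 2 * (1 + L) * p k ω ≤ 1
  p_cube_le : ∀ k ω, p k ω ^ 3 ≤ b k
  summable_b : Summable b
  condExp_G : ∀ k, P[G k | H k] =ᵐ[P] fun ω => D (x k ω)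
  condExp_G_sq : ∀ k, P[fun ω => G k ω ^ 2 | H k] ≤ᵐ[P] fun ω => σ₀ * D (x k ω) ^ 2 + σ₁

namespace AdaptiveStepRecursion

variable {Ω : Type*} {m0 : MeasurableSpace Ω} {P : Measure Ω}
  {H : Filtration ℕ m0} {D : ℝ → ℝ} {L R δ σ₀ σ₁ K : ℝ} {b : ℕ → ℝ} {x p G : ℕ → Ω → ℝ}

/-- The Lyapunov function `|x| + K |D x| p`. -/
def potential (D : ℝ → ℝ) (K : ℝ) (x p : ℕ → Ω → ℝ) (k : ℕ) (ω : Ω) : ℝ :=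
  |x k ω| + K * |D (x k ω)| * p k ω

/-- Above this level of the potential, the iterate is outside the critical region. -/
def lowerLevel (D : ℝ → ℝ) (L R K : ℝ) : ℝ := R + K * (|D 0| + L * R)

/-- Above `lowerLevel + gap`, the gradient is controlled by the excess of the potential. -/
def gap (D : ℝ → ℝ) (L R K : ℝ) : ℝ := |D 0| + L * lowerLevel D L R K

/-- Excess of the potential over `lowerLevel`. -/
def excess (D : ℝ → ℝ) (L R K : ℝ) (x p : ℕ → Ω → ℝ) (k : ℕ) (ω : Ω) : ℝ :=
  max (potential D K x p k ω - lowerLevel D L R K) 0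

/-- Indicator that the excess is larger than `gap`. -/
noncomputable def isHigh (D : ℝ → ℝ) (L R K : ℝ) (x p : ℕ → Ω → ℝ) (k : ℕ) (ω : Ω) : ℝ :=
  open Classical in if gap D L R K < excess D L R K x p k ω then 1 else 0

lemma abs_D_le (h : AdaptiveStepRecursion P H D L R δ σ₀ σ₁ K b x p G) (t : ℝ) :
    |D t| ≤ |D 0| + L * |t| := by
  have := h.lipschitz t 0
  rw [sub_zero] at this
  linarith [abs_sub_abs_le_abs_sub (D t) (D 0)]

lemma continuous_D (h : AdaptiveStepRecursion P H D L R δ σ₀ σ₁ K b x p G) : Continuous D := by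
  refine (LipschitzWith.of_dist_le_mul (K := L.toNNReal) fun s t => ?_).continuous
  rw [Real.coe_toNNReal _ h.L_nonneg]
  exact h.lipschitz s t

lemma one_le_K_sq_mul (h : AdaptiveStepRecursion P H D L R δ σ₀ σ₁ K b x p G) :
    1 ≤ K ^ 2 * (1 + L) := by
  have h1 : 1 ≤ K ^ 2 := one_le_pow₀ h.one_le_K
  nlinarith [h.L_nonneg]

lemma p_le_one (h : AdaptiveStepRecursion P H D L R δ σ₀ σ₁ K b x p G) (k : ℕ) (ω : Ω) :
    p k ω ≤ 1 := by
  nlinarith [h.p_small k ω, h.one_le_K_sq_mul, h.p_pos k ω]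

lemma K_mul_p_le (h : AdaptiveStepRecursion P H D L R δ σ₀ σ₁ K b x p G) (k : ℕ) (ω : Ω) :
    40 * (K ^ 2 * L * p k ω) ≤ 1 := by
  have h1 := h.p_small k ω
  have h2 : 0 ≤ K ^ 2 * p k ω := mul_nonneg (sq_nonneg K) (h.p_pos k ω).le
  nlinarith

lemma K_mul_L_mul_p_le (h : AdaptiveStepRecursion P H D L R δ σ₀ σ₁ K b x p G) (k : ℕ) (ω : Ω) :
    40 * (K * L * p k ω) ≤ 1 := by
  have h1 := h.K_mul_p_le k ω
  have h2 : 0 ≤ L * p k ω := mul_nonneg h.L_nonneg (h.p_pos k ω).le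
  have h3 : K ≤ K ^ 2 := by nlinarith [h.one_le_K]
  nlinarith [mul_le_mul_of_nonneg_right h3 h2]

lemma K_mul_L_mul_p_le_one (h : AdaptiveStepRecursion P H D L R δ σ₀ σ₁ K b x p G) (k : ℕ) (ω : Ω) :
    K * L * p k ω ≤ 1 := by
  have h1 := h.K_mul_L_mul_p_le k ω
  have h2 : 0 ≤ K * L * p k ω :=
    mul_nonneg (mul_nonneg (zero_le_one.trans h.one_le_K) h.L_nonneg) (h.p_pos k ω).le
  linarith

lemma lowerLevel_nonneg (h : AdaptiveStepRecursion P H D L R δ σ₀ σ₁ K b x p G) :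
    0 ≤ lowerLevel D L R K := by
  have := h.one_le_R
  have := h.one_le_K
  have := h.L_nonneg
  unfold lowerLevel
  positivity

lemma gap_nonneg (h : AdaptiveStepRecursion P H D L R δ σ₀ σ₁ K b x p G) :
    0 ≤ gap D L R K := by
  have := h.lowerLevel_nonneg
  have := h.L_nonneg
  unfold gap
  positivity

lemma abs_le_potential (h : AdaptiveStepRecursion P H D L R δ σ₀ σ₁ K b x p G) (k : ℕ) (ω : Ω) :
    |x k ω| ≤ potential D K x p k ω := by
  have := h.p_pos k ω
  have := h.one_le_K
  unfold potential
  have : 0 ≤ K * |D (x k ω)| * p k ω := by positivity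
  linarith

lemma excess_nonneg (k : ℕ) (ω : Ω) : 0 ≤ excess D L R K x p k ω := le_max_right _ _

lemma potential_le_excess_add (k : ℕ) (ω : Ω) :
    potential D K x p k ω ≤ excess D L R K x p k ω + lowerLevel D L R K := by
  have := le_max_left (potential D K x p k ω - lowerLevel D L R K) 0
  unfold excess
  linarith

lemma isHigh_nonneg (k : ℕ) (ω : Ω) : 0 ≤ isHigh D L R K x p k ω := by
  unfold isHigh; split_ifs <;> simp

lemma isHigh_le_one (k : ℕ) (ω : Ω) : isHigh D L R K x p k ω ≤ 1 := by
  unfold isHigh; split_ifs <;> simp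

lemma le_abs_of_excess_pos (h : AdaptiveStepRecursion P H D L R δ σ₀ σ₁ K b x p G) {k : ℕ} {ω : Ω}
    (hpos : 0 < excess D L R K x p k ω) : R ≤ |x k ω| := by
  by_contra! hlt
  have h1 : |D (x k ω)| ≤ |D 0| + L * R :=
    (h.abs_D_le _).trans (by have := h.L_nonneg; gcongr)
  have hK := h.one_le_K
  have h2 : K * |D (x k ω)| * p k ω ≤ K * (|D 0| + L * R) * 1 := by
    gcongr
    · exact (h.p_pos k ω).le
    · exact mul_nonneg (by linarith) ((abs_nonneg _).trans h1)
    · exact h.p_le_one k ω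
  have h3 : potential D K x p k ω ≤ lowerLevel D L R K := by
    unfold potential lowerLevel; linarith
  unfold excess at hpos
  rw [max_eq_right (by linarith)] at hpos
  exact lt_irrefl _ hpos

lemma isHigh_eq_zero (h : AdaptiveStepRecursion P H D L R δ σ₀ σ₁ K b x p G) {k : ℕ} {ω : Ω}
    (he : excess D L R K x p k ω = 0) : isHigh D L R K x p k ω = 0 := by
  unfold isHigh
  rw [if_neg]
  rw [he]
  exact not_lt.2 h.gap_nonneg

lemma exists_bound (h : AdaptiveStepRecursion P H D L R δ σ₀ σ₁ K b x p G) (k : ℕ) :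
    ∃ C, 0 ≤ C ∧ ∀ ω, potential D K x p k ω ≤ C ∧ |D (x k ω)| ≤ C ∧
      excess D L R K x p k ω ≤ C := by
  have hx : ∃ C, ∀ ω, |x k ω| ≤ C := by
    induction k with
    | zero => exact h.bdd_zero
    | succ k ih =>
      obtain ⟨C, hC⟩ := ih
      refine ⟨C + 1, fun ω => ?_⟩
      rw [h.step]
      refine (abs_sub _ _).trans (add_le_add (hC ω) ?_)
      rw [abs_mul, abs_of_pos (h.p_pos _ _), mul_comm]
      exact h.abs_step_le k ω
  obtain ⟨C, hC0, hC⟩ : ∃ C, 0 ≤ C ∧ ∀ ω, |x k ω| ≤ C := by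
    obtain ⟨C, hC⟩ := hx
    exact ⟨|C|, abs_nonneg C, fun ω => (hC ω).trans (le_abs_self C)⟩
  have hL := h.L_nonneg
  have hK := h.one_le_K
  have hD : ∀ ω, |D (x k ω)| ≤ |D 0| + L * C := fun ω =>
    (h.abs_D_le _).trans (by gcongr; exact hC ω)
  have hp : ∀ ω, potential D K x p k ω ≤ C + K * (|D 0| + L * C) * 1 := fun ω => by
    have h1 := h.p_le_one k ω
    have h2 := (h.p_pos k ω).le
    unfold potential
    gcongr
    · exact hC ω
    · exact hD ω
  have hnn : 0 ≤ C + K * (|D 0| + L * C) * 1 := by positivity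
  refine ⟨C + K * (|D 0| + L * C) * 1, hnn, fun ω => ⟨hp ω, ?_, ?_⟩⟩
  · refine (hD ω).trans ?_
    have : 0 ≤ |D 0| + L * C := by positivity
    nlinarith
  · unfold excess
    refine max_le ?_ hnn
    linarith [hp ω, h.lowerLevel_nonneg]

lemma measurable_D (h : AdaptiveStepRecursion P H D L R δ σ₀ σ₁ K b x p G) (k : ℕ) :
    Measurable[H k] fun ω => D (x k ω) := h.continuous_D.measurable.comp (h.measurable_x k)

lemma measurable_potential (h : AdaptiveStepRecursion P H D L R δ σ₀ σ₁ K b x p G) (k : ℕ) :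
    Measurable[H k] (potential D K x p k) := by
  have h1 := h.measurable_D k
  have h2 := h.measurable_x k
  have h3 := h.measurable_p k
  unfold potential
  exact (continuous_abs.measurable.comp h2).add
    (((continuous_abs.measurable.comp h1).const_mul K).mul h3)

lemma measurable_excess (h : AdaptiveStepRecursion P H D L R δ σ₀ σ₁ K b x p G) (k : ℕ) :
    Measurable[H k] (excess D L R K x p k) := by
  unfold excess
  exact ((h.measurable_potential k).sub_const _).max measurable_const

lemma measurable_isHigh (h : AdaptiveStepRecursion P H D L R δ σ₀ σ₁ K b x p G) (k : ℕ) :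
    Measurable[H k] (isHigh D L R K x p k) := by
  unfold isHigh
  exact Measurable.ite (measurableSet_lt measurable_const (h.measurable_excess k))
    measurable_const measurable_const

lemma abs_D_succ_sub_le (h : AdaptiveStepRecursion P H D L R δ σ₀ σ₁ K b x p G) (k : ℕ) (ω : Ω) :
    |D (x (k + 1) ω) - D (x k ω)| ≤ L * (|G k ω| * p (k + 1) ω) := by
  refine (h.lipschitz _ _).trans (le_of_eq ?_)
  rw [h.step, sub_sub_cancel_left, abs_neg, abs_mul, abs_of_pos (h.p_pos _ _), mul_comm (p _ _)]

lemma abs_D_succ_le (h : AdaptiveStepRecursion P H D L R δ σ₀ σ₁ K b x p G) (k : ℕ) (ω : Ω) :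
    |D (x (k + 1) ω)| ≤ |D (x k ω)| + L * (|G k ω| * p (k + 1) ω) := by
  linarith [h.abs_D_succ_sub_le k ω, abs_sub_abs_le_abs_sub (D (x (k + 1) ω)) (D (x k ω))]

lemma potential_succ_le_add_two (h : AdaptiveStepRecursion P H D L R δ σ₀ σ₁ K b x p G)
    (k : ℕ) (ω : Ω) : potential D K x p (k + 1) ω ≤ potential D K x p k ω + 2 := by
  have h1 := potential_le_add (x := x k ω) (h.p_pos (k + 1) ω) (h.p_anti k ω)
    (h.abs_D_succ_le k ω) h.one_le_K h.L_nonneg (h.K_mul_L_mul_p_le_one k ω)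
  rw [← h.step] at h1
  unfold potential
  linarith [h.abs_step_le k ω]

lemma sq_increment_le (h : AdaptiveStepRecursion P H D L R δ σ₀ σ₁ K b x p G) (k : ℕ) (ω : Ω) :
    (potential D K x p (k + 1) ω - potential D K x p k ω) ^ 2 ≤
      8 * p k ω ^ 2 * G k ω ^ 2 + 2 * K ^ 2 * D (x k ω) ^ 2 * p k ω ^ 2 := by
  have h1 := sq_potential_increment_le (x := x k ω) (h.p_pos (k + 1) ω) (h.p_anti k ω)
    (h.abs_D_succ_sub_le k ω) h.one_le_K h.L_nonneg (h.K_mul_L_mul_p_le_one k ω)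
  rw [← h.step] at h1
  exact h1

lemma increment_le (h : AdaptiveStepRecursion P H D L R δ σ₀ σ₁ K b x p G) {k : ℕ} {ω : Ω}
    (hpos : 0 < excess D L R K x p k ω) :
    potential D K x p (k + 1) ω - potential D K x p k ω ≤
      -(D (x k ω) / |D (x k ω)| * p k ω) * G k ω
        + ((p k ω / (4 * K) + K * L * p k ω ^ 2 / 2) / |D (x k ω)|) * G k ω ^ 2
        + K * L * |D (x k ω)| * p k ω ^ 2 / 2 := by
  have hR := h.le_abs_of_excess_pos hpos
  have h1 := potential_increment_le (x := x k ω) (h.one_le_R.trans hR)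
    (h.δ_pos.trans_le (h.le_abs_of_le _ hR)) (h.mul_nonneg_of_le _ hR) (h.p_pos (k + 1) ω)
    (h.p_anti k ω) (h.abs_step_le k ω) (h.abs_D_succ_le k ω) h.one_le_K h.L_nonneg
  rw [← h.step] at h1
  exact h1

/-- Expected drift of the potential outside the critical region. -/
lemma condExp_mul_increment_le [IsProbabilityMeasure P]
    (h : AdaptiveStepRecursion P H D L R δ σ₀ σ₁ K b x p G) (k : ℕ) {u : Ω → ℝ}
    (hu : Measurable[H k] u) (hu0 : ∀ ω, 0 ≤ u ω) {C : ℝ} (huC : ∀ ω, u ω ≤ C)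
    (hu1 : ∀ ω, excess D L R K x p k ω = 0 → u ω = 0)
    (hYint : Integrable
      (fun ω => u ω * (potential D K x p (k + 1) ω - potential D K x p k ω)) P) :
    P[fun ω => u ω * (potential D K x p (k + 1) ω - potential D K x p k ω) | H k] ≤ᵐ[P]
      fun ω => -(1 / 2) * (u ω * |D (x k ω)| * p k ω) := by
  have hDm := h.measurable_D k
  have hDa : Measurable[H k] fun ω => |D (x k ω)| := continuous_abs.measurable.comp hDm
  have hpm := h.measurable_p k
  have hK := h.one_le_K
  have hL := h.L_nonneg
  have hδ := h.δ_pos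
  obtain ⟨B, hB0, hB⟩ := h.exists_bound k
  have hout : ∀ ω, u ω ≠ 0 → 0 < excess D L R K x p k ω ∧ δ ≤ |D (x k ω)| := by
    intro ω hne
    have h1 : 0 < excess D L R K x p k ω :=
      lt_of_le_of_ne (excess_nonneg k ω) fun he => hne (hu1 ω he.symm)
    exact ⟨h1, h.le_abs_of_le _ (h.le_abs_of_excess_pos h1)⟩
  have hp1 : ∀ ω, p k ω / (4 * K) ≤ 1 := fun ω => by
    rw [div_le_one (by linarith)]; linarith [h.p_le_one k ω]
  have hp2 : ∀ ω, K * L * p k ω ^ 2 / 2 ≤ 1 := fun ω => by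
    nlinarith [h.K_mul_L_mul_p_le_one k ω, h.p_le_one k ω, h.p_pos k ω]
  have key := condExp_le_of_le_quadratic (H.le k) (h.memLp_G k) hYint
    (α := fun ω => -(u ω * (D (x k ω) / |D (x k ω)| * p k ω)))
    (β := fun ω => u ω * ((p k ω / (4 * K) + K * L * p k ω ^ 2 / 2) / |D (x k ω)|))
    (γ := fun ω => u ω * (K * L * |D (x k ω)| * p k ω ^ 2 / 2))
    (hu.mul ((hDm.div hDa).mul hpm)).neg.stronglyMeasurable
    (hu.mul (((hpm.div_const _).add (((hpm.pow_const 2).const_mul _).div_const _)).div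
      hDa)).stronglyMeasurable
    (hu.mul (((hDa.const_mul _).mul (hpm.pow_const 2)).div_const _)).stronglyMeasurable
    ⟨C, fun ω => by
      rw [abs_neg, abs_mul, abs_of_nonneg (hu0 ω), abs_mul, abs_of_pos (h.p_pos k ω), abs_div,
        abs_abs]
      have h1 : |D (x k ω)| / |D (x k ω)| * p k ω ≤ 1 * 1 :=
        mul_le_mul (div_self_le_one _) (h.p_le_one k ω) (h.p_pos k ω).le zero_le_one
      nlinarith [hu0 ω, huC ω]⟩
    ⟨C * (2 / δ), fun ω => by
      have hpp := h.p_pos k ω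
      have hnn := hu0 ω
      have hCn := hnn.trans (huC ω)
      rw [abs_of_nonneg (by positivity)]
      by_cases hz : u ω = 0
      · rw [hz, zero_mul]; positivity
      · have hd := (hout ω hz).2
        have h1 := hp1 ω
        have h2 := hp2 ω
        gcongr
        · exact huC ω
        · linarith⟩
    ⟨C * (K * L * B * 1 ^ 2 / 2), fun ω => by
      have hpp := h.p_pos k ω
      have hnn := hu0 ω
      have hCn := hnn.trans (huC ω)
      rw [abs_of_nonneg (by positivity)]
      have h1 := (hB ω).2.1
      have h2 := h.p_le_one k ω
      gcongr
      exact huC ω⟩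
    (fun ω => by
      have hpp := h.p_pos k ω
      have hnn := hu0 ω
      positivity)
    (fun ω => by
      by_cases hz : u ω = 0
      · simp [hz]
      · have := mul_le_mul_of_nonneg_left (h.increment_le (hout ω hz).1) (hu0 ω)
        linarith)
    (h.condExp_G k) (h.condExp_G_sq k)
  filter_upwards [key] with ω hω
  refine hω.trans ?_
  by_cases hz : u ω = 0
  · simp [hz]
  · have hd := (hout ω hz).2
    have hr : 0 < |D (x k ω)| := hδ.trans_le hd
    have hpp := h.p_pos k ω
    have hnoise := h.noise_le _ hd
    set r := |D (x k ω)| with hr_def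
    have e1 : D (x k ω) / r * p k ω * D (x k ω) = r * p k ω := by
      have : D (x k ω) * D (x k ω) = r * r := (abs_mul_abs_self _).symm
      field_simp
      linarith
    have e2 : (p k ω / (4 * K) + K * L * p k ω ^ 2 / 2) / r * (σ₀ * D (x k ω) ^ 2 + σ₁)
        ≤ r * p k ω * (1 / 4 + K ^ 2 * L * p k ω / 2) := by
      calc _ ≤ (p k ω / (4 * K) + K * L * p k ω ^ 2 / 2) / r * (K * D (x k ω) ^ 2) := by
            gcongr
        _ = _ := by
            rw [← sq_abs (D (x k ω)), ← hr_def]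
            field_simp
    have hmul := mul_le_mul_of_nonneg_left e2 (hu0 ω)
    have h40 := h.K_mul_p_le k ω
    have h41 := h.K_mul_L_mul_p_le k ω
    have hur : 0 ≤ u ω * (r * p k ω) := mul_nonneg (hu0 ω) (mul_nonneg hr.le hpp.le)
    have h42 : u ω * (r * p k ω) * (K ^ 2 * L * p k ω + K * L * p k ω)
        ≤ u ω * (r * p k ω) * (1 / 20) := mul_le_mul_of_nonneg_left (by linarith) hur
    have e3 : u ω * (D (x k ω) / r * p k ω * D (x k ω)) = u ω * (r * p k ω) := by rw [e1]
    linarith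

lemma integral_mul_sq_le [IsProbabilityMeasure P]
    (h : AdaptiveStepRecursion P H D L R δ σ₀ σ₁ K b x p G) (k : ℕ) {w : Ω → ℝ}
    (hw : Measurable[H k] w) (hw0 : ∀ ω, 0 ≤ w ω) {C : ℝ} (hwC : ∀ ω, w ω ≤ C) :
    Integrable (fun ω => w ω * G k ω ^ 2) P ∧
    Integrable (fun ω => w ω * (σ₀ * D (x k ω) ^ 2 + σ₁)) P ∧
    ∫ ω, w ω * G k ω ^ 2 ∂P ≤ ∫ ω, w ω * (σ₀ * D (x k ω) ^ 2 + σ₁) ∂P := by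
  have hwC' : ∀ ω, |w ω| ≤ C := fun ω => by rw [abs_of_nonneg (hw0 ω)]; exact hwC ω
  obtain ⟨B, hB0, hB⟩ := h.exists_bound k
  have hDm := h.measurable_D k
  have hσ₀ := h.σ₀_nonneg
  have hσ₁ := h.σ₁_nonneg
  have hwm0 : AEStronglyMeasurable w P := (hw.mono (H.le k) le_rfl).aestronglyMeasurable
  have i1 : Integrable (fun ω => w ω * G k ω ^ 2) P :=
    (h.memLp_G k).integrable_sq.bdd_mul hwm0 (ae_of_all _ hwC')
  have i0 : Integrable (fun ω => σ₀ * D (x k ω) ^ 2 + σ₁) P := by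
    refine Integrable.of_bound (C := σ₀ * B ^ 2 + σ₁) ?_ (ae_of_all _ fun ω => ?_)
    · exact ((((hDm.pow_const 2).const_mul σ₀).add_const σ₁).mono
        (H.le k) le_rfl).aestronglyMeasurable
    · rw [Real.norm_of_nonneg (by positivity), ← sq_abs]
      have := (hB ω).2.1
      gcongr
  have i2 : Integrable (fun ω => w ω * (σ₀ * D (x k ω) ^ 2 + σ₁)) P :=
    i0.bdd_mul hwm0 (ae_of_all _ hwC')
  refine ⟨i1, i2, ?_⟩
  have key := condExp_le_of_le_quadratic (H.le k) (h.memLp_G k) i1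
    (α := fun _ => 0) (β := w) (γ := fun _ => 0) stronglyMeasurable_const hw.stronglyMeasurable
    stronglyMeasurable_const ⟨0, by simp⟩ ⟨C, hwC'⟩ ⟨0, by simp⟩ hw0 (fun ω => by simp)
    (h.condExp_G k) (h.condExp_G_sq k)
  rw [← integral_condExp (H.le k)]
  refine integral_mono_ae integrable_condExp i2 ?_
  filter_upwards [key] with ω hω
  simpa using hω

lemma integrable_of_measurable_of_bound [IsProbabilityMeasure P] {k : ℕ} {f : Ω → ℝ}
    (hf : Measurable[H k] f) {C : ℝ} (hC : ∀ ω, |f ω| ≤ C) : Integrable f P :=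
  Integrable.of_bound (C := C) (hf.mono (H.le k) le_rfl).aestronglyMeasurable
    (ae_of_all _ hC)

/-- Pointwise bound on the drift of `excess ^ 2 * p`. -/
lemma drift_sq_excess_le (h : AdaptiveStepRecursion P H D L R δ σ₀ σ₁ K b x p G) (k : ℕ) (ω : Ω) :
    -(excess D L R K x p k ω * |D (x k ω)| * p k ω ^ 2)
      + (8 * (σ₀ * D (x k ω) ^ 2 + σ₁) + 2 * K ^ 2 * D (x k ω) ^ 2) * p k ω ^ 3
    ≤ -(1 / (2 * (1 + L))) * (isHigh D L R K x p k ω * D (x k ω) ^ 2 * p k ω ^ 2)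
      + (8 * (σ₀ * (|D 0| + L * (gap D L R K + lowerLevel D L R K)) ^ 2 + σ₁)
        + 2 * K ^ 2 * (|D 0| + L * (gap D L R K + lowerLevel D L R K)) ^ 2) * p k ω ^ 3 := by
  have hp := h.p_pos k ω
  have hK := h.one_le_K
  have hL := h.L_nonneg
  have hσ₀ := h.σ₀_nonneg
  have hσ₁ := h.σ₁_nonneg
  have hU := excess_nonneg (D := D) (L := L) (R := R) (K := K) (x := x) (p := p) k ω
  have hxU := (h.abs_le_potential k ω).trans
    (potential_le_excess_add (D := D) (L := L) (R := R) (K := K) (x := x) (p := p) k ω)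
  have hgap := h.gap_nonneg
  have hlow := h.lowerLevel_nonneg
  rw [← sq_abs (D (x k ω))]
  set U := excess D L R K x p k ω with hU_def
  set B := |D 0| + L * (gap D L R K + lowerLevel D L R K) with hB_def
  have hB0 : 0 ≤ B := by positivity
  by_cases hhigh : gap D L R K < U
  · have h1 : isHigh D L R K x p k ω = 1 := by unfold isHigh; rw [if_pos hhigh]
    have hr := h.le_abs_of_le _ (h.le_abs_of_excess_pos (hgap.trans_lt hhigh))
    have hQ := h.noise_le _ hr
    have hrU : |D (x k ω)| ≤ (1 + L) * U := by
      have e1 := h.abs_D_le (x k ω)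
      have e2 : L * |x k ω| ≤ L * (U + lowerLevel D L R K) := by gcongr
      have e3 : |D 0| + L * lowerLevel D L R K ≤ U := hhigh.le
      linarith
    rw [h1]
    rw [← sq_abs (D (x k ω))] at hQ
    set r := |D (x k ω)| with hr_def
    have hr0 : 0 ≤ r := abs_nonneg _
    have hsmall := h.p_small k ω
    have e4 : 8 * (σ₀ * r ^ 2 + σ₁) + 2 * K ^ 2 * r ^ 2 ≤ 10 * K ^ 2 * r ^ 2 := by
      have : K * r ^ 2 ≤ K ^ 2 * r ^ 2 := by
        gcongr
        nlinarith
      linarith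
    have e5 : (8 * (σ₀ * r ^ 2 + σ₁) + 2 * K ^ 2 * r ^ 2) * p k ω ^ 3
        ≤ 10 * K ^ 2 * r ^ 2 * p k ω ^ 3 := by gcongr
    have e6 : 10 * K ^ 2 * p k ω ≤ 1 / (4 * (1 + L)) := by
      rw [le_div_iff₀ (by positivity)]
      linarith
    have e7 : 10 * K ^ 2 * r ^ 2 * p k ω ^ 3 ≤ 1 / (4 * (1 + L)) * (r ^ 2 * p k ω ^ 2) := by
      calc _ = 10 * K ^ 2 * p k ω * (r ^ 2 * p k ω ^ 2) := by ring
        _ ≤ _ := by gcongr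
    have e8 : 1 / (1 + L) * (r ^ 2 * p k ω ^ 2) ≤ U * r * p k ω ^ 2 := by
      rw [div_mul_eq_mul_div, div_le_iff₀ (by positivity)]
      have : r * (r * p k ω ^ 2) ≤ (1 + L) * U * (r * p k ω ^ 2) := by gcongr
      linarith
    have e9 : 1 / (4 * (1 + L)) = 1 / (1 + L) / 4 := by field_simp
    have e10 : 1 / (2 * (1 + L)) = 1 / (1 + L) / 2 := by field_simp
    have e11 : 0 ≤ (8 * (σ₀ * B ^ 2 + σ₁) + 2 * K ^ 2 * B ^ 2) * p k ω ^ 3 := by positivity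
    have e12 : 0 ≤ 1 / (1 + L) * (r ^ 2 * p k ω ^ 2) := by positivity
    rw [e9] at e7
    rw [e10]
    linarith
  · have h1 : isHigh D L R K x p k ω = 0 := by unfold isHigh; rw [if_neg hhigh]
    rw [h1]
    have hrB : |D (x k ω)| ≤ B := by
      refine (h.abs_D_le (x k ω)).trans ?_
      rw [hB_def]
      have : |x k ω| ≤ gap D L R K + lowerLevel D L R K := by linarith
      gcongr
    have e1 : 0 ≤ U * |D (x k ω)| * p k ω ^ 2 := by positivity
    have e2 : (8 * (σ₀ * |D (x k ω)| ^ 2 + σ₁) + 2 * K ^ 2 * |D (x k ω)| ^ 2) * p k ω ^ 3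
        ≤ (8 * (σ₀ * B ^ 2 + σ₁) + 2 * K ^ 2 * B ^ 2) * p k ω ^ 3 := by gcongr
    linarith

/-- Recursive inequality for `excess ^ 2 * p`. -/
lemma sq_excess_mul_succ_le (h : AdaptiveStepRecursion P H D L R δ σ₀ σ₁ K b x p G)
    (k : ℕ) (ω : Ω) :
    excess D L R K x p (k + 1) ω ^ 2 * p (k + 1) ω ≤
      excess D L R K x p k ω ^ 2 * p k ω
        + 2 * (excess D L R K x p k ω * p k ω
          * (potential D K x p (k + 1) ω - potential D K x p k ω))
        + (8 * p k ω ^ 3 * G k ω ^ 2 + 2 * K ^ 2 * D (x k ω) ^ 2 * p k ω ^ 3) := by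
  have hp := h.p_pos k ω
  have hp' := h.p_pos (k + 1) ω
  have hpp := h.p_anti k ω
  have hsq := h.sq_increment_le k ω
  set Δ := potential D K x p (k + 1) ω - potential D K x p k ω with hΔ
  have hU := excess_nonneg (D := D) (L := L) (R := R) (K := K) (x := x) (p := p) k ω
  have hpot := potential_le_excess_add (D := D) (L := L) (R := R) (K := K) (x := x) (p := p) k ω
  have h1 : excess D L R K x p (k + 1) ω ≤ |excess D L R K x p k ω + Δ| := by
    refine max_le ?_ (abs_nonneg _)
    refine le_trans ?_ (le_abs_self _)
    linarith
  have h2 : excess D L R K x p (k + 1) ω ^ 2 ≤ (excess D L R K x p k ω + Δ) ^ 2 := by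
    rw [← sq_abs (excess D L R K x p k ω + Δ)]
    exact pow_le_pow_left₀ (excess_nonneg _ _) h1 2
  calc _ ≤ (excess D L R K x p k ω + Δ) ^ 2 * p k ω := by gcongr
    _ = excess D L R K x p k ω ^ 2 * p k ω + 2 * (excess D L R K x p k ω * p k ω * Δ)
        + Δ ^ 2 * p k ω := by ring
    _ ≤ _ := by
      have := mul_le_mul_of_nonneg_right hsq hp.le
      linarith

/-- One-step decrease, in expectation, of `excess ^ 2 * p`. -/
lemma integral_sq_excess_mul_succ_le [IsProbabilityMeasure P]
    (h : AdaptiveStepRecursion P H D L R δ σ₀ σ₁ K b x p G) (k : ℕ) :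
    ∫ ω, excess D L R K x p (k + 1) ω ^ 2 * p (k + 1) ω ∂P
      + 1 / (2 * (1 + L)) * ∫ ω, isHigh D L R K x p k ω * D (x k ω) ^ 2 * p k ω ^ 2 ∂P ≤
    ∫ ω, excess D L R K x p k ω ^ 2 * p k ω ∂P
      + (8 * (σ₀ * (|D 0| + L * (gap D L R K + lowerLevel D L R K)) ^ 2 + σ₁)
        + 2 * K ^ 2 * (|D 0| + L * (gap D L R K + lowerLevel D L R K)) ^ 2) * b k := by
  have hK := h.one_le_K
  have hL := h.L_nonneg
  have hσ₀ := h.σ₀_nonneg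
  have hσ₁ := h.σ₁_nonneg
  obtain ⟨B, hB0, hB⟩ := h.exists_bound k
  have hDm := h.measurable_D k
  have hDa : Measurable[H k] fun ω => |D (x k ω)| := continuous_abs.measurable.comp hDm
  have hpm := h.measurable_p k
  have hUm := h.measurable_excess k
  have hp1 := h.p_le_one k
  have hp0 : ∀ ω, 0 ≤ p k ω := fun ω => (h.p_pos k ω).le
  have hUn : ∀ ω, 0 ≤ excess D L R K x p k ω := fun ω => excess_nonneg k ω
  have hUB : ∀ ω, excess D L R K x p k ω ≤ B := fun ω => (hB ω).2.2
  have hDB : ∀ ω, |D (x k ω)| ≤ B := fun ω => (hB ω).2.1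
  have hIn : ∀ ω, 0 ≤ isHigh D L R K x p k ω := fun ω => isHigh_nonneg k ω
  have hI1 : ∀ ω, isHigh D L R K x p k ω ≤ 1 := fun ω => isHigh_le_one k ω
  have hD2 : ∀ ω, D (x k ω) ^ 2 ≤ B ^ 2 := fun ω => by
    rw [← sq_abs]; exact pow_le_pow_left₀ (abs_nonneg _) (hDB ω) 2
  have hWint : ∀ j, Integrable (fun ω => excess D L R K x p j ω ^ 2 * p j ω) P := by
    intro j
    obtain ⟨B', hB0', hB'⟩ := h.exists_bound j
    refine integrable_of_measurable_of_bound (C := B' ^ 2 * 1)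
      (((h.measurable_excess j).pow_const 2).mul (h.measurable_p j)) fun ω => ?_
    have e1 := excess_nonneg (D := D) (L := L) (R := R) (K := K) (x := x) (p := p) j ω
    have e2 := h.p_pos j ω
    rw [abs_of_nonneg (by positivity)]
    have := (hB' ω).2.2
    have := h.p_le_one j ω
    gcongr
  obtain ⟨B', hB0', hB'⟩ := h.exists_bound (k + 1)
  have hYint : Integrable (fun ω => excess D L R K x p k ω * p k ω
      * (potential D K x p (k + 1) ω - potential D K x p k ω)) P := by
    refine integrable_of_measurable_of_bound (H := H) (k := k + 1) (C := B * 1 * (B' + B)) ?_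
      fun ω => ?_
    · exact ((hUm.mul hpm).mono (H.mono k.le_succ) le_rfl).mul
        ((h.measurable_potential (k + 1)).sub
          ((h.measurable_potential k).mono (H.mono k.le_succ) le_rfl))
    · have e1 : 0 ≤ potential D K x p (k + 1) ω :=
        (abs_nonneg _).trans (h.abs_le_potential (k + 1) ω)
      have e2 : 0 ≤ potential D K x p k ω := (abs_nonneg _).trans (h.abs_le_potential k ω)
      have e3 := (hB ω).1
      have e4 := (hB' ω).1
      have e5 : |potential D K x p (k + 1) ω - potential D K x p k ω| ≤ B' + B := by
        rw [abs_le]; constructor <;> linarith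
      rw [abs_mul, abs_of_nonneg (mul_nonneg (hUn ω) (hp0 ω))]
      have := hUB ω
      have := hp1 ω
      have := hp0 ω
      gcongr
  have hY := h.condExp_mul_increment_le k (hUm.mul hpm)
    (fun ω => mul_nonneg (hUn ω) (hp0 ω)) (C := B * 1)
    (fun ω => mul_le_mul (hUB ω) (hp1 ω) (hp0 ω) hB0)
    (fun ω he => by
      show excess D L R K x p k ω * p k ω = 0
      rw [he, zero_mul]) hYint
  have hTint : Integrable (fun ω => excess D L R K x p k ω * |D (x k ω)| * p k ω ^ 2) P := by
    refine integrable_of_measurable_of_bound (C := B * B * 1 ^ 2)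
      ((hUm.mul hDa).mul (hpm.pow_const 2)) fun ω => ?_
    have := hUB ω
    have := hp1 ω
    have := hp0 ω
    have := hDB ω
    have := hUn ω
    rw [abs_of_nonneg (by positivity)]
    gcongr
  have hYle : ∫ ω, excess D L R K x p k ω * p k ω
      * (potential D K x p (k + 1) ω - potential D K x p k ω) ∂P
      ≤ ∫ ω, -(1 / 2) * (excess D L R K x p k ω * |D (x k ω)| * p k ω ^ 2) ∂P := by
    rw [← integral_condExp (H.le k)]
    refine integral_mono_ae integrable_condExp (hTint.const_mul _) ?_
    filter_upwards [hY] with ω hω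
    refine hω.trans (le_of_eq ?_)
    show -(1 / 2) * (excess D L R K x p k ω * p k ω * |D (x k ω)| * p k ω) = _
    ring
  obtain ⟨iG, iQ, hG⟩ := h.integral_mul_sq_le k (w := fun ω => 8 * p k ω ^ 3) (C := 8 * 1 ^ 3)
    ((hpm.pow_const 3).const_mul 8) (fun ω => by have := hp0 ω; positivity)
    (fun ω => by have := hp0 ω; have := hp1 ω; gcongr)
  have hDint : Integrable (fun ω => 2 * K ^ 2 * D (x k ω) ^ 2 * p k ω ^ 3) P := by
    refine integrable_of_measurable_of_bound (C := 2 * K ^ 2 * B ^ 2 * 1 ^ 3)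
      (((hDm.pow_const 2).const_mul _).mul (hpm.pow_const 3)) fun ω => ?_
    have := hp1 ω
    have := hp0 ω
    have := hD2 ω
    rw [abs_of_nonneg (by positivity)]
    gcongr
  have hSint : Integrable (fun ω => isHigh D L R K x p k ω * D (x k ω) ^ 2 * p k ω ^ 2) P := by
    refine integrable_of_measurable_of_bound (C := 1 * B ^ 2 * 1 ^ 2)
      (((h.measurable_isHigh k).mul (hDm.pow_const 2)).mul (hpm.pow_const 2)) fun ω => ?_
    have := hp1 ω
    have := hp0 ω
    have := hD2 ω
    have := hI1 ω
    have := hIn ω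
    rw [abs_of_nonneg (by positivity)]
    gcongr
  have step1 := integral_mono (hWint (k + 1))
    (((hWint k).add (hYint.const_mul 2)).add (iG.add hDint)) fun ω => h.sq_excess_mul_succ_le k ω
  rw [integral_add' ((hWint k).add (hYint.const_mul 2)) (iG.add hDint),
    integral_add' (hWint k) (hYint.const_mul 2), integral_add' iG hDint,
    integral_const_mul] at step1
  rw [integral_const_mul] at hYle
  set C := 8 * (σ₀ * (|D 0| + L * (gap D L R K + lowerLevel D L R K)) ^ 2 + σ₁)
        + 2 * K ^ 2 * (|D 0| + L * (gap D L R K + lowerLevel D L R K)) ^ 2 with hC_def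
  have hC0 : 0 ≤ C := by positivity
  have step2 := integral_mono (μ := P) ((hTint.neg.add iQ).add hDint)
    ((hSint.const_mul (-(1 / (2 * (1 + L))))).add (integrable_const (C * b k))) fun ω => by
      have e1 := h.drift_sq_excess_le k ω
      have e2 : C * p k ω ^ 3 ≤ C * b k := by gcongr; exact h.p_cube_le k ω
      simp only [Pi.add_apply, Pi.neg_apply]
      rw [← hC_def] at e1
      linarith
  rw [integral_add' (hTint.neg.add iQ) hDint, integral_add' hTint.neg iQ, integral_neg',
    integral_add' (hSint.const_mul _) (integrable_const _), integral_const_mul, integral_const,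
    probReal_univ, one_smul] at step2
  linarith

/-- The squared gradient steps taken at high potential are summable in expectation. -/
lemma exists_sum_integral_le [IsProbabilityMeasure P]
    (h : AdaptiveStepRecursion P H D L R δ σ₀ σ₁ K b x p G) :
    ∃ C, ∀ n, ∑ k ∈ Finset.range n,
      ∫ ω, isHigh D L R K x p k ω * D (x k ω) ^ 2 * p k ω ^ 2 ∂P ≤ C := by
  have hL := h.L_nonneg
  have hσ₀ := h.σ₀_nonneg
  have hσ₁ := h.σ₁_nonneg
  set C := 8 * (σ₀ * (|D 0| + L * (gap D L R K + lowerLevel D L R K)) ^ 2 + σ₁)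
        + 2 * K ^ 2 * (|D 0| + L * (gap D L R K + lowerLevel D L R K)) ^ 2 with hC_def
  have hC0 : 0 ≤ C := by positivity
  set W : ℕ → ℝ := fun k => ∫ ω, excess D L R K x p k ω ^ 2 * p k ω ∂P with hW
  set S : ℕ → ℝ := fun k => ∫ ω, isHigh D L R K x p k ω * D (x k ω) ^ 2 * p k ω ^ 2 ∂P with hS
  have hstep : ∀ k, W (k + 1) + 1 / (2 * (1 + L)) * S k ≤ W k + C * b k :=
    h.integral_sq_excess_mul_succ_le
  have hW0 : ∀ k, 0 ≤ W k := fun k =>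
    integral_nonneg fun ω => mul_nonneg (sq_nonneg _) (h.p_pos k ω).le
  have hb0 : ∀ k, 0 ≤ b k := fun k => by
    obtain ⟨ω⟩ := P.nonempty_of_neZero
    exact (pow_pos (h.p_pos k ω) 3).le.trans (h.p_cube_le k ω)
  have hsum : ∀ n, W n + 1 / (2 * (1 + L)) * ∑ k ∈ Finset.range n, S k
      ≤ W 0 + C * ∑ k ∈ Finset.range n, b k := by
    intro n
    induction n with
    | zero => simp
    | succ n ih =>
      rw [Finset.sum_range_succ, Finset.sum_range_succ]
      linarith [hstep n]
  refine ⟨(W 0 + C * ∑' k, b k) * (2 * (1 + L)), fun n => ?_⟩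
  have h1 : ∑ k ∈ Finset.range n, b k ≤ ∑' k, b k :=
    h.summable_b.sum_le_tsum _ fun k _ => hb0 k
  have h2 := mul_le_mul_of_nonneg_left h1 hC0
  rw [← div_le_iff₀ (by positivity)]
  have h3 := hsum n
  have h4 := hW0 n
  rw [one_div_mul_eq_div] at h3
  linarith

lemma integral_isHigh_mul_sq_le [IsProbabilityMeasure P]
    (h : AdaptiveStepRecursion P H D L R δ σ₀ σ₁ K b x p G) (k : ℕ) :
    ∫ ω, (isHigh D L R K x p k ω
        * (potential D K x p (k + 1) ω - potential D K x p k ω)) ^ 2 ∂P ≤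
      (8 * K + 2 * K ^ 2) * ∫ ω, isHigh D L R K x p k ω * D (x k ω) ^ 2 * p k ω ^ 2 ∂P := by
  have hK := h.one_le_K
  have hσ₀ := h.σ₀_nonneg
  have hσ₁ := h.σ₁_nonneg
  obtain ⟨B, hB0, hB⟩ := h.exists_bound k
  have hDm := h.measurable_D k
  have hpm := h.measurable_p k
  have hIm := h.measurable_isHigh k
  have hp1 := h.p_le_one k
  have hp0 : ∀ ω, 0 ≤ p k ω := fun ω => (h.p_pos k ω).le
  have hIn : ∀ ω, 0 ≤ isHigh D L R K x p k ω := fun ω => isHigh_nonneg k ω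
  have hI1 : ∀ ω, isHigh D L R K x p k ω ≤ 1 := fun ω => isHigh_le_one k ω
  have hD2 : ∀ ω, D (x k ω) ^ 2 ≤ B ^ 2 := fun ω => by
    rw [← sq_abs]; exact pow_le_pow_left₀ (abs_nonneg _) (hB ω).2.1 2
  obtain ⟨iG, iQ, hG⟩ := h.integral_mul_sq_le k
    (w := fun ω => 8 * isHigh D L R K x p k ω * p k ω ^ 2) (C := 8 * 1 * 1 ^ 2)
    ((hIm.const_mul 8).mul (hpm.pow_const 2))
    (fun ω => by have := hp0 ω; have := hIn ω; positivity)
    (fun ω => by have := hp0 ω; have := hp1 ω; have := hI1 ω; gcongr)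
  have hSint : Integrable (fun ω => isHigh D L R K x p k ω * D (x k ω) ^ 2 * p k ω ^ 2) P := by
    refine integrable_of_measurable_of_bound (C := 1 * B ^ 2 * 1 ^ 2)
      ((hIm.mul (hDm.pow_const 2)).mul (hpm.pow_const 2)) fun ω => ?_
    have := hp1 ω
    have := hp0 ω
    have := hD2 ω
    have := hI1 ω
    have := hIn ω
    rw [abs_of_nonneg (by positivity)]
    gcongr
  have hsq : ∀ ω, isHigh D L R K x p k ω ^ 2 = isHigh D L R K x p k ω := fun ω => by
    unfold isHigh; split_ifs <;> simp
  have hQ : ∀ ω, 8 * isHigh D L R K x p k ω * p k ω ^ 2 * (σ₀ * D (x k ω) ^ 2 + σ₁)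
      ≤ 8 * K * (isHigh D L R K x p k ω * D (x k ω) ^ 2 * p k ω ^ 2) := fun ω => by
    by_cases hz : isHigh D L R K x p k ω = 0
    · simp [hz]
    · have hpos : 0 < excess D L R K x p k ω :=
        lt_of_le_of_ne (excess_nonneg k ω) fun he => hz (h.isHigh_eq_zero he.symm)
      have hn := h.noise_le _ (h.le_abs_of_le _ (h.le_abs_of_excess_pos hpos))
      have : 0 ≤ 8 * isHigh D L R K x p k ω * p k ω ^ 2 := by
        have := hIn ω
        positivity
      linarith [mul_le_mul_of_nonneg_left hn this]
  calc _ ≤ ∫ ω, (8 * isHigh D L R K x p k ω * p k ω ^ 2 * G k ω ^ 2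
          + 2 * K ^ 2 * (isHigh D L R K x p k ω * D (x k ω) ^ 2 * p k ω ^ 2)) ∂P := by
        refine integral_mono_of_nonneg (ae_of_all _ fun ω => sq_nonneg _)
          (iG.add (hSint.const_mul _)) (ae_of_all _ fun ω => ?_)
        have := mul_le_mul_of_nonneg_left (h.sq_increment_le k ω) (hIn ω)
        simp only [mul_pow, hsq]
        linarith
    _ = ∫ ω, 8 * isHigh D L R K x p k ω * p k ω ^ 2 * G k ω ^ 2 ∂P
        + 2 * K ^ 2 * ∫ ω, isHigh D L R K x p k ω * D (x k ω) ^ 2 * p k ω ^ 2 ∂P := by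
        rw [integral_add iG (hSint.const_mul _), integral_const_mul]
    _ ≤ 8 * K * ∫ ω, isHigh D L R K x p k ω * D (x k ω) ^ 2 * p k ω ^ 2 ∂P
        + 2 * K ^ 2 * ∫ ω, isHigh D L R K x p k ω * D (x k ω) ^ 2 * p k ω ^ 2 ∂P := by
        gcongr
        refine hG.trans ?_
        rw [← integral_const_mul]
        exact integral_mono iQ (hSint.const_mul _) hQ
    _ = _ := by ring

/-- The squared iterates have an integrable supremum. -/
theorem lintegral_iSup_sq_lt_top [IsProbabilityMeasure P]
    (h : AdaptiveStepRecursion P H D L R δ σ₀ σ₁ K b x p G) :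
    ∫⁻ ω, ⨆ n, ENNReal.ofReal (x n ω ^ 2) ∂P < ⊤ := by
  have hK := h.one_le_K
  obtain ⟨C, hC⟩ := h.exists_sum_integral_le
  set Z := potential D K x p with hZ
  set Y : ℕ → Ω → ℝ := fun k ω => isHigh D L R K x p k ω * (Z (k + 1) ω - Z k ω) with hY
  set E : ℕ → Ω → ℝ := fun k => P[Y k | H k] with hE
  set ζ : ℕ → Ω → ℝ := fun k => Y k - E k with hζ
  have hYm : ∀ k, StronglyMeasurable[H (k + 1)] (Y k) := fun k =>
    (((h.measurable_isHigh k).mono (H.mono k.le_succ) le_rfl).mul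
      ((h.measurable_potential (k + 1)).sub
        ((h.measurable_potential k).mono (H.mono k.le_succ) le_rfl))).stronglyMeasurable
  have hY2 : ∀ k, MemLp (Y k) 2 P := fun k => by
    obtain ⟨B, hB0, hB⟩ := h.exists_bound k
    obtain ⟨B', hB0', hB'⟩ := h.exists_bound (k + 1)
    refine MemLp.of_bound ((hYm k).mono (H.le _)).aestronglyMeasurable (1 * (B' + B))
      (ae_of_all _ fun ω => ?_)
    have e1 : 0 ≤ Z (k + 1) ω := (abs_nonneg _).trans (h.abs_le_potential (k + 1) ω)
    have e2 : 0 ≤ Z k ω := (abs_nonneg _).trans (h.abs_le_potential k ω)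
    have e3 : Z k ω ≤ B := (hB ω).1
    have e4 : Z (k + 1) ω ≤ B' := (hB' ω).1
    have e5 : |Z (k + 1) ω - Z k ω| ≤ B' + B := by
      rw [abs_le]; constructor <;> linarith
    rw [Real.norm_eq_abs, hY, abs_mul, abs_of_nonneg (isHigh_nonneg k ω)]
    have := isHigh_le_one (D := D) (L := L) (R := R) (K := K) (x := x) (p := p) k ω
    gcongr
  have hYint : ∀ k, Integrable (Y k) P := fun k => (hY2 k).integrable one_le_two
  have hEm : ∀ k, StronglyMeasurable[H k] (E k) := fun k => stronglyMeasurable_condExp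
  have hE2 : ∀ k, MemLp (E k) 2 P := fun k => (hY2 k).condExp one_le_two
  have hE0 : ∀ k, E k ≤ᵐ[P] 0 := fun k => by
    have := h.condExp_mul_increment_le k (h.measurable_isHigh k) (isHigh_nonneg k)
      (isHigh_le_one k) (fun ω he => h.isHigh_eq_zero he) (hYint k)
    filter_upwards [this] with ω hω
    refine hω.trans ?_
    have e1 := h.p_pos k ω
    have e2 := isHigh_nonneg (D := D) (L := L) (R := R) (K := K) (x := x) (p := p) k ω
    have : 0 ≤ isHigh D L R K x p k ω * |D (x k ω)| * p k ω := by positivity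
    simp only [Pi.zero_apply]
    linarith
  have hζ2 : ∀ k, MemLp (ζ k) 2 P := fun k => (hY2 k).sub (hE2 k)
  have hζc : ∀ k, P[ζ k | H k] =ᵐ[P] 0 := fun k => by
    have e1 := condExp_sub (hYint k) ((hE2 k).integrable one_le_two) (H k)
    have e2 : P[E k | H k] = E k :=
      condExp_of_stronglyMeasurable (H.le k) (hEm k) ((hE2 k).integrable one_le_two)
    rw [e2] at e1
    filter_upwards [e1] with ω hω
    rw [hω]
    simp [hE]
  have hζm : ∀ k, StronglyMeasurable[H (k + 1)] (ζ k) := fun k =>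
    (hYm k).sub ((hEm k).mono (H.mono k.le_succ))
  have hζsq : ∀ k, ∫ ω, ζ k ω ^ 2 ∂P ≤ ∫ ω, Y k ω ^ 2 ∂P := fun k => by
    have h0 := integral_mul_eq_zero_of_condExp_eq_zero (H.le k) (hEm k) (hE2 k) (hζ2 k) (hζc k)
    have i1 : Integrable (fun ω => E k ω * ζ k ω) P := (hE2 k).integrable_mul (hζ2 k)
    have i2 := (hζ2 k).integrable_sq
    have i3 := (hY2 k).integrable_sq
    have := integral_mono (i2.add (i1.const_mul 2)) i3 fun ω => by
      have : Y k ω = ζ k ω + E k ω := by simp [hζ]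
      simp only [Pi.add_apply]
      rw [this]
      nlinarith [sq_nonneg (E k ω)]
    rw [integral_add' i2 (i1.const_mul 2), integral_const_mul, h0] at this
    linarith
  have hsum : ∀ n, ∑ k ∈ Finset.range n, ∫ ω, ζ k ω ^ 2 ∂P ≤ (8 * K + 2 * K ^ 2) * C := by
    intro n
    calc _ ≤ ∑ k ∈ Finset.range n, (8 * K + 2 * K ^ 2)
          * ∫ ω, isHigh D L R K x p k ω * D (x k ω) ^ 2 * p k ω ^ 2 ∂P :=
          Finset.sum_le_sum fun k _ => (hζsq k).trans (h.integral_isHigh_mul_sq_le k)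
      _ ≤ _ := by
          rw [← Finset.mul_sum]
          have := hC n
          gcongr
  have hmax := lintegral_iSup_sq_sum_le H hζm hζ2 hζc hsum
  obtain ⟨B₀, hB₀0, hB₀⟩ := h.exists_bound 0
  have hgap := h.gap_nonneg
  have hlow := h.lowerLevel_nonneg
  set M := max B₀ (lowerLevel D L R K + gap D L R K + 2) with hM
  set N : ℕ → Ω → ℝ := fun n ω => ∑ k ∈ Finset.range n, ζ k ω with hN
  have hpath : ∀ᵐ ω ∂P, ∀ n, ∃ m, Z n ω ≤ M + N n ω - N m ω := by
    filter_upwards [ae_all_iff.2 hE0] with ω hω n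
    induction n with
    | zero =>
      refine ⟨0, ?_⟩
      have : Z 0 ω ≤ B₀ := (hB₀ ω).1
      linarith [le_max_left B₀ (lowerLevel D L R K + gap D L R K + 2)]
    | succ n ih =>
      by_cases hhigh : gap D L R K < excess D L R K x p n ω
      · obtain ⟨m, hm⟩ := ih
        refine ⟨m, ?_⟩
        have e1 : isHigh D L R K x p n ω = 1 := by unfold isHigh; rw [if_pos hhigh]
        have e2 : ζ n ω = Z (n + 1) ω - Z n ω - E n ω := by simp [hζ, hY, e1]
        have e3 : N (n + 1) ω = N n ω + ζ n ω := by simp only [hN, Finset.sum_range_succ]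
        have e4 : E n ω ≤ 0 := hω n
        linarith
      · refine ⟨n + 1, ?_⟩
        have e1 : Z (n + 1) ω ≤ Z n ω + 2 := h.potential_succ_le_add_two n ω
        have e2 : Z n ω ≤ excess D L R K x p n ω + lowerLevel D L R K :=
          potential_le_excess_add n ω
        linarith [le_max_right B₀ (lowerLevel D L R K + gap D L R K + 2)]
  have hbound : ∀ᵐ ω ∂P, ⨆ n, ENNReal.ofReal (x n ω ^ 2) ≤
      ENNReal.ofReal (2 * M ^ 2) + 8 * ⨆ n, ENNReal.ofReal (N n ω ^ 2) := by
    filter_upwards [hpath] with ω hω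
    refine iSup_le fun n => ?_
    obtain ⟨m, hm⟩ := hω n
    have e1 : |x n ω| ≤ Z n ω := h.abs_le_potential n ω
    have e2 : x n ω ^ 2 ≤ 2 * M ^ 2 + (4 * N n ω ^ 2 + 4 * N m ω ^ 2) := by
      rw [← sq_abs]
      have e3 : |x n ω| ^ 2 ≤ (M + N n ω - N m ω) ^ 2 :=
        pow_le_pow_left₀ (abs_nonneg _) (e1.trans hm) 2
      nlinarith [sq_nonneg (M - (N n ω - N m ω)), sq_nonneg (N n ω + N m ω)]
    calc ENNReal.ofReal (x n ω ^ 2)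
        ≤ ENNReal.ofReal (2 * M ^ 2 + (4 * N n ω ^ 2 + 4 * N m ω ^ 2)) :=
          ENNReal.ofReal_le_ofReal e2
      _ = ENNReal.ofReal (2 * M ^ 2) + (4 * ENNReal.ofReal (N n ω ^ 2)
            + 4 * ENNReal.ofReal (N m ω ^ 2)) := by
          rw [ENNReal.ofReal_add (by positivity) (by positivity),
            ENNReal.ofReal_add (by positivity) (by positivity),
            ENNReal.ofReal_mul (by norm_num), ENNReal.ofReal_mul (by norm_num)]
          norm_num
      _ ≤ ENNReal.ofReal (2 * M ^ 2) + (4 * (⨆ n, ENNReal.ofReal (N n ω ^ 2))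
            + 4 * ⨆ n, ENNReal.ofReal (N n ω ^ 2)) := by
          gcongr
          · exact le_iSup (fun n => ENNReal.ofReal (N n ω ^ 2)) n
          · exact le_iSup (fun n => ENNReal.ofReal (N n ω ^ 2)) m
      _ = _ := by rw [← add_mul]; norm_num
  calc _ ≤ ∫⁻ ω, (ENNReal.ofReal (2 * M ^ 2) + 8 * ⨆ n, ENNReal.ofReal (N n ω ^ 2)) ∂P :=
        lintegral_mono_ae hbound
    _ = ENNReal.ofReal (2 * M ^ 2) + 8 * ∫⁻ ω, ⨆ n, ENNReal.ofReal (N n ω ^ 2) ∂P := by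
        rw [lintegral_add_left measurable_const, lintegral_const_mul' _ _ (by norm_num)]
        simp
    _ < ⊤ := by
        refine ENNReal.add_lt_top.2 ⟨ENNReal.ofReal_lt_top, ENNReal.mul_lt_top (by norm_num) ?_⟩
        exact hmax.trans_lt ENNReal.ofReal_lt_top

end AdaptiveStepRecursion

/-- A nonnegative function whose derivative stays away from zero on `[a, ∞)` is increasing
there. -/
lemma deriv_pos_of_nonneg_of_lt_abs {φ φ' : ℝ → ℝ} {a δ : ℝ} (hφ : ∀ t, HasDerivAt φ (φ' t) t)
    (hc : Continuous φ') (h0 : ∀ t, 0 ≤ φ t) (hδ : 0 < δ) (hlt : ∀ t, a ≤ t → δ < |φ' t|)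
    {t : ℝ} (ht : a ≤ t) : 0 < φ' t := by
  by_contra! hneg
  have hne : ∀ s, a ≤ s → φ' s ≠ 0 := fun s hs h => by
    have := hlt s hs
    rw [h, abs_zero] at this
    linarith
  have hall : ∀ s, a ≤ s → φ' s < -δ := by
    intro s hs
    have hs' : φ' s < 0 := by
      by_contra! hpos
      obtain ⟨r, hr, hr0⟩ := isPreconnected_Ici.intermediate_value (Set.mem_Ici.2 ht)
        (Set.mem_Ici.2 hs) hc.continuousOn ⟨hneg, hpos⟩
      exact hne r hr hr0
    have := hlt s hs
    rw [abs_of_neg hs'] at this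
    linarith
  have hanti : AntitoneOn (fun s => φ s + δ * s) (Set.Ici a) := by
    have hd : ∀ s, HasDerivAt (fun s => φ s + δ * s) (φ' s + δ) s := fun s => by
      exact (hφ s).add (by simpa using (hasDerivAt_id s).const_mul δ)
    refine antitoneOn_of_deriv_nonpos (convex_Ici a)
      (fun s _ => (hd s).continuousAt.continuousWithinAt)
      (fun s _ => (hd s).differentiableAt.differentiableWithinAt) fun s hs => ?_
    rw [interior_Ici] at hs
    rw [(hd s).deriv]
    linarith [hall s (le_of_lt hs)]
  have h1 : a ≤ a + (φ a + 1) / δ := by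
    have := h0 a
    have : 0 ≤ (φ a + 1) / δ := by positivity
    linarith
  have h2 := hanti (Set.mem_Ici.2 le_rfl) (Set.mem_Ici.2 h1) h1
  simp only [mul_add, mul_div_cancel₀ _ hδ.ne'] at h2
  linarith [h0 (a + (φ a + 1) / δ)]

lemma deriv_neg_of_nonneg_of_lt_abs {φ φ' : ℝ → ℝ} {a δ : ℝ} (hφ : ∀ t, HasDerivAt φ (φ' t) t)
    (hc : Continuous φ') (h0 : ∀ t, 0 ≤ φ t) (hδ : 0 < δ) (hlt : ∀ t, t ≤ a → δ < |φ' t|)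
    {t : ℝ} (ht : t ≤ a) : φ' t < 0 := by
  have := deriv_pos_of_nonneg_of_lt_abs (φ := fun s => φ (-s)) (φ' := fun s => -φ' (-s))
    (a := -a) (δ := δ) (t := -t)
    (fun s => by simpa [Function.comp_def] using (hφ (-s)).scomp s (hasDerivAt_neg s))
    (hc.comp continuous_neg).neg (fun s => h0 _) hδ
    (fun s hs => by rw [abs_neg]; exact hlt _ (by linarith)) (by linarith)
  rw [neg_neg] at this
  linarith

section Gradient

variable {d : ℕ} {g : EuclideanSpace ℝ (Fin d) → ℝ}

lemma hasDerivAt_comp_line (hg : ContDiff ℝ 1 g) (y : EuclideanSpace ℝ (Fin d)) (i : Fin d)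
    (t : ℝ) : HasDerivAt (fun s : ℝ => g (y + s • EuclideanSpace.single i (1 : ℝ)))
      (gradient g (y + t • EuclideanSpace.single i (1 : ℝ)) i) t := by
  have h1 := ((hg.differentiable one_ne_zero) (y + t • EuclideanSpace.single i (1 : ℝ)))
    |>.hasGradientAt.hasFDerivAt
  have h2 : HasDerivAt (fun s : ℝ => y + s • EuclideanSpace.single i (1 : ℝ))
      (EuclideanSpace.single i (1 : ℝ)) t := by
    simpa using ((hasDerivAt_id t).smul_const (EuclideanSpace.single i (1 : ℝ))).const_add y
  have h3 := h1.comp_hasDerivAt t h2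
  have h4 : InnerProductSpace.toDual ℝ _ (gradient g (y + t • EuclideanSpace.single i (1 : ℝ)))
      (EuclideanSpace.single i (1 : ℝ))
      = gradient g (y + t • EuclideanSpace.single i (1 : ℝ)) i := by
    rw [InnerProductSpace.toDual_apply_apply, EuclideanSpace.inner_single_right]
    simp
  rw [h4] at h3
  exact h3

lemma continuous_gradient_line {L : ℝ} (hL : 0 < L)
    (hg : ∀ x y, ‖gradient g x - gradient g y‖ ≤ L * ‖x - y‖)
    (y : EuclideanSpace ℝ (Fin d)) (i : Fin d) :
    Continuous fun s : ℝ => gradient g (y + s • EuclideanSpace.single i (1 : ℝ)) i := by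
  have h1 : Continuous (gradient g) := by
    refine (LipschitzWith.of_dist_le_mul (K := L.toNNReal) fun s t => ?_).continuous
    rw [Real.coe_toNNReal _ hL.le, dist_eq_norm, dist_eq_norm]
    exact hg s t
  exact (EuclideanSpace.proj (𝕜 := ℝ) i).continuous.comp
    (h1.comp (continuous_const.add (continuous_id.smul continuous_const)))

/-- In dimension at least two, a nonnegative smooth function cannot have all partial derivatives
bounded away from zero at infinity. -/
lemma false_of_forall_lt_abs_gradient {L δ : ℝ} (hL : 0 < L) (hg : ContDiff ℝ 1 g)
    (hg0 : ∀ x, 0 ≤ g x) (hgL : ∀ x y, ‖gradient g x - gradient g y‖ ≤ L * ‖x - y‖)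
    (hδ : 0 < δ) {i j : Fin d} (hij : i ≠ j)
    (hflat : ∀ᶠ x in Bornology.cobounded (EuclideanSpace ℝ (Fin d)), δ < |gradient g x i|) :
    False := by
  obtain ⟨R, -, hR⟩ := hasBasis_cobounded_norm.eventually_iff.1 hflat
  set y : EuclideanSpace ℝ (Fin d) := R • EuclideanSpace.single j (1 : ℝ) with hy
  have hlt : ∀ t : ℝ, δ < |gradient g (y + t • EuclideanSpace.single i (1 : ℝ)) i| := by
    intro t
    refine hR ?_
    have h1 := PiLp.norm_apply_le (y + t • EuclideanSpace.single i (1 : ℝ)) j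
    have h2 : (y + t • EuclideanSpace.single i (1 : ℝ)) j = R := by
      simp [hy, hij.symm]
    rw [h2, Real.norm_eq_abs] at h1
    exact (le_abs_self R).trans h1
  have hd := hasDerivAt_comp_line hg y i
  have hc := continuous_gradient_line hL hgL y i
  have h1 := deriv_pos_of_nonneg_of_lt_abs hd hc (fun t => hg0 _) hδ (a := 0)
    (fun t _ => hlt t) le_rfl
  have h2 := deriv_neg_of_nonneg_of_lt_abs hd hc (fun t => hg0 _) hδ (a := 0)
    (fun t _ => hlt t) le_rfl
  linarith

end Gradient

lemma le_quadratic_of_hasDerivAt {φ φ' : ℝ → ℝ} {L : ℝ} (hL : 0 ≤ L)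
    (hφ : ∀ t, HasDerivAt φ (φ' t) t) (hlip : ∀ s t, |φ' s - φ' t| ≤ L * |s - t|)
    (h0 : ∀ t, 0 ≤ φ t) (t : ℝ) : φ t ≤ (φ 0 + |φ' 0| + L) * (1 + t ^ 2) := by
  have hb : ∀ s ∈ Set.Icc (-|t|) |t|, ‖φ' s‖ ≤ |φ' 0| + L * |t| := by
    intro s hs
    have h1 := hlip s 0
    rw [sub_zero] at h1
    have h2 : L * |s| ≤ L * |t| := by
      have := abs_le.2 hs
      gcongr
    rw [Real.norm_eq_abs]
    linarith [abs_sub_abs_le_abs_sub (φ' s) (φ' 0)]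
  have h1 := (convex_Icc (-|t|) |t|).norm_image_sub_le_of_norm_hasDerivWithin_le (x := 0) (y := t)
    (fun s _ => (hφ s).hasDerivWithinAt) hb
    ⟨by linarith [abs_nonneg t], abs_nonneg t⟩ ⟨neg_abs_le t, le_abs_self t⟩
  rw [sub_zero, Real.norm_eq_abs, Real.norm_eq_abs] at h1
  have h2 := (le_abs_self _).trans h1
  have h3 := h0 0
  have h4 : |t| ^ 2 = t ^ 2 := sq_abs t
  have h5 : |φ' 0| * |t| ≤ |φ' 0| * (1 + t ^ 2) := by
    gcongr
    nlinarith [sq_nonneg (|t| - 1), abs_nonneg t]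
  nlinarith [mul_nonneg h3 (sq_nonneg t)]

/-- RMSProp step sizes built from the second moment estimate `V`. -/
noncomputable def rmspropStep (ε : ℝ) (V : ℕ → ℝ) (n : ℕ) : ℝ :=
  1 / Real.sqrt n / (Real.sqrt (V n) + ε)

section RMSPropStep

variable {β v ε : ℝ} {V G : ℕ → ℝ}

lemma rmspropStep_pos (hε : 0 < ε) {n : ℕ} (hn : 1 ≤ n) : 0 < rmspropStep ε V n := by
  have : (0 : ℝ) < n := by exact_mod_cast hn
  unfold rmspropStep
  positivity

lemma rmspropStep_le (hε : 0 < ε) (n : ℕ) : rmspropStep ε V n ≤ 1 / Real.sqrt n / ε := by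
  unfold rmspropStep
  gcongr
  linarith [Real.sqrt_nonneg (V n)]

lemma second_moment_nonneg (hβ : β ∈ Set.Ioo (0 : ℝ) 1) (hv : 0 < v)
    (h1 : V 1 = β * v + (1 - β) * G 1 ^ 2)
    (hrec : ∀ n : ℕ, 2 ≤ n → V n = (1 - 1 / (n : ℝ)) * V (n - 1) + 1 / (n : ℝ) * G n ^ 2)
    {n : ℕ} (hn : 1 ≤ n) : 0 ≤ V n := by
  induction n, hn using Nat.le_induction with
  | base =>
    have := hβ.1
    have : 0 ≤ 1 - β := by linarith [hβ.2]
    rw [h1]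
    positivity
  | succ n hn ih =>
    rw [hrec (n + 1) (by lia), Nat.add_sub_cancel]
    have : 1 / ((n + 1 : ℕ) : ℝ) ≤ 1 := by
      rw [div_le_one (by positivity)]
      push_cast
      linarith [Nat.cast_nonneg (α := ℝ) n]
    have : 0 ≤ 1 - 1 / ((n + 1 : ℕ) : ℝ) := by linarith
    positivity

lemma mul_second_moment_succ
    (hrec : ∀ n : ℕ, 2 ≤ n → V n = (1 - 1 / (n : ℝ)) * V (n - 1) + 1 / (n : ℝ) * G n ^ 2)
    {n : ℕ} (hn : 1 ≤ n) :
    ((n + 1 : ℕ) : ℝ) * V (n + 1) = n * V n + G (n + 1) ^ 2 := by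
  rw [hrec (n + 1) (by lia), Nat.add_sub_cancel]
  field_simp
  push_cast
  ring

lemma rmspropStep_eq {n : ℕ} (ε : ℝ) :
    rmspropStep ε V n = 1 / (Real.sqrt (n * V n) + Real.sqrt n * ε) := by
  rw [rmspropStep, div_div, mul_add, Real.sqrt_mul (Nat.cast_nonneg n)]

lemma rmspropStep_succ_le (hε : 0 < ε)
    (hrec : ∀ n : ℕ, 2 ≤ n → V n = (1 - 1 / (n : ℝ)) * V (n - 1) + 1 / (n : ℝ) * G n ^ 2)
    {n : ℕ} (hn : 1 ≤ n) : rmspropStep ε V (n + 1) ≤ rmspropStep ε V n := by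
  have hn0 : (0 : ℝ) < n := by exact_mod_cast hn
  rw [rmspropStep_eq, rmspropStep_eq, mul_second_moment_succ hrec hn]
  have e1 : Real.sqrt (n * V n) ≤ Real.sqrt (n * V n + G (n + 1) ^ 2) :=
    Real.sqrt_le_sqrt (by linarith [sq_nonneg (G (n + 1))])
  have e2 : Real.sqrt (n : ℝ) ≤ Real.sqrt ((n + 1 : ℕ) : ℝ) :=
    Real.sqrt_le_sqrt (by push_cast; linarith)
  have e3 : 0 < Real.sqrt (n * V n) + Real.sqrt n * ε := by positivity
  gcongr

lemma abs_mul_rmspropStep_succ_le (hβ : β ∈ Set.Ioo (0 : ℝ) 1) (hv : 0 < v) (hε : 0 < ε)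
    (h1 : V 1 = β * v + (1 - β) * G 1 ^ 2)
    (hrec : ∀ n : ℕ, 2 ≤ n → V n = (1 - 1 / (n : ℝ)) * V (n - 1) + 1 / (n : ℝ) * G n ^ 2)
    {n : ℕ} (hn : 1 ≤ n) : |G (n + 1)| * rmspropStep ε V (n + 1) ≤ 1 := by
  have hV := second_moment_nonneg hβ hv h1 hrec hn
  rw [rmspropStep_eq, mul_second_moment_succ hrec hn, mul_one_div]
  have e1 : |G (n + 1)| ≤ Real.sqrt (n * V n + G (n + 1) ^ 2) := by
    rw [← Real.sqrt_sq_eq_abs]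
    exact Real.sqrt_le_sqrt (by have : 0 ≤ n * V n := by positivity
                                linarith)
  refine div_le_one_of_le₀ ?_ (by positivity)
  have : 0 ≤ Real.sqrt ((n + 1 : ℕ) : ℝ) * ε := by positivity
  linarith

lemma abs_mul_rmspropStep_le (hβ : β ∈ Set.Ioo (0 : ℝ) 1) (hv : 0 < v) (hε : 0 < ε)
    (h1 : V 1 = β * v + (1 - β) * G 1 ^ 2)
    (hrec : ∀ n : ℕ, 2 ≤ n → V n = (1 - 1 / (n : ℝ)) * V (n - 1) + 1 / (n : ℝ) * G n ^ 2)
    (n : ℕ) : |G (n + 1)| * rmspropStep ε V (n + 1) ≤ 1 / Real.sqrt (1 - β) := by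
  have hβ' : 0 < 1 - β := by linarith [hβ.2]
  rcases Nat.eq_zero_or_pos n with rfl | hn
  · have e1 : Real.sqrt (1 - β) * |G 1| ≤ Real.sqrt (V 1) := by
      rw [← Real.sqrt_sq_eq_abs, ← Real.sqrt_mul hβ'.le, h1]
      exact Real.sqrt_le_sqrt (by have := mul_pos hβ.1 hv
                                  linarith)
    have e2 : 0 < Real.sqrt (1 - β) := Real.sqrt_pos.2 hβ'
    rw [zero_add, rmspropStep, Nat.cast_one, Real.sqrt_one, div_one, mul_one_div,
      div_le_div_iff₀ (by positivity) e2]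
    linarith
  · refine (abs_mul_rmspropStep_succ_le hβ hv hε h1 hrec hn).trans ?_
    rw [le_div_iff₀ (Real.sqrt_pos.2 hβ'), one_mul, Real.sqrt_le_one]
    linarith [hβ.1]

end RMSPropStep

/-- A filtration started at a later time. -/
def shiftFiltration {Ω : Type*} {m0 : MeasurableSpace Ω} (ℱ : Filtration ℕ m0) (m : ℕ) :
    Filtration ℕ m0 where
  seq k := ℱ (m + k)
  mono' _ _ hij := ℱ.mono (Nat.add_le_add_left hij m)
  le' k := ℱ.le (m + k)

lemma rmspropStep_cube_le {ε : ℝ} (hε : 0 < ε) {V : ℕ → ℝ} {m : ℕ} (hm : 1 ≤ m) (k : ℕ) :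
    rmspropStep ε V (m + k) ^ 3 ≤ (ε⁻¹) ^ 3 * ((k + 1 : ℕ) : ℝ) ^ (-(3 / 2) : ℝ) := by
  have hk : (0 : ℝ) < ((k + 1 : ℕ) : ℝ) := by positivity
  have h1 : rmspropStep ε V (m + k) ≤ ε⁻¹ * ((k + 1 : ℕ) : ℝ) ^ (-(1 / 2) : ℝ) := by
    refine (rmspropStep_le hε _).trans ?_
    rw [Real.rpow_neg hk.le, ← Real.sqrt_eq_rpow, div_eq_inv_mul, one_div]
    have : Real.sqrt ((k + 1 : ℕ) : ℝ) ≤ Real.sqrt ((m + k : ℕ) : ℝ) :=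
      Real.sqrt_le_sqrt (by exact_mod_cast (by lia : k + 1 ≤ m + k))
    have : 0 < Real.sqrt ((k + 1 : ℕ) : ℝ) := Real.sqrt_pos.2 hk
    gcongr
  calc _ ≤ (ε⁻¹ * ((k + 1 : ℕ) : ℝ) ^ (-(1 / 2) : ℝ)) ^ 3 :=
        pow_le_pow_left₀ (rmspropStep_pos hε (by lia)).le h1 3
    _ = _ := by
        rw [mul_pow, ← Real.rpow_natCast (((k + 1 : ℕ) : ℝ) ^ (-(1 / 2) : ℝ)),
          ← Real.rpow_mul hk.le]
        norm_num

/-- Stability of function values for RMSProp in dimension one. -/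
theorem rmsprop_stability_real {Ω : Type*} {m0 : MeasurableSpace Ω} {P : Measure Ω}
    [IsProbabilityMeasure P] (ℱ : Filtration ℕ m0) {φ D : ℝ → ℝ}
    {L σ₀ σ₁ v ε β R δ θ₁ : ℝ} (hL : 0 < L) (hσ₀ : 0 ≤ σ₀) (hσ₁ : 0 ≤ σ₁) (hv : 0 < v)
    (hε : 0 < ε) (hβ : β ∈ Set.Ioo (0 : ℝ) 1)
    (hφ : ∀ t, HasDerivAt φ (D t) t) (hφ0 : ∀ t, 0 ≤ φ t)
    (hD : ∀ s t, |D s - D t| ≤ L * |s - t|) (hδ : 0 < δ) (hflat : ∀ t, R ≤ |t| → δ < |D t|)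
    {G θ V : ℕ → Ω → ℝ} (hG_meas : ∀ n, 1 ≤ n → Measurable[ℱ n] (G n))
    (hG_memLp : ∀ n, 1 ≤ n → MemLp (G n) 2 P)
    (hθ_meas : ∀ n, 1 ≤ n → Measurable[ℱ (n - 1)] (θ n)) (hθ_init : ∀ ω, θ 1 ω = θ₁)
    (hV1 : ∀ ω, V 1 ω = β * v + (1 - β) * G 1 ω ^ 2)
    (hV_rec : ∀ n : ℕ, 2 ≤ n → ∀ ω,
      V n ω = (1 - 1 / (n : ℝ)) * V (n - 1) ω + (1 / (n : ℝ)) * G n ω ^ 2)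
    (hθ_rec : ∀ n : ℕ, 1 ≤ n → ∀ ω,
      θ (n + 1) ω = θ n ω - (1 / Real.sqrt (n : ℝ)) / (Real.sqrt (V n ω) + ε) * G n ω)
    (hG_unbiased : ∀ n, 1 ≤ n → P[G n | ℱ (n - 1)] =ᵐ[P] fun ω => D (θ n ω))
    (hG_var : ∀ n, 1 ≤ n → P[fun ω => G n ω ^ 2 | ℱ (n - 1)] ≤ᵐ[P]
      fun ω => σ₀ * D (θ n ω) ^ 2 + σ₁) :
    ∫⁻ ω, ⨆ n : ℕ, ENNReal.ofReal (φ (θ (n + 1) ω)) ∂P < ⊤ := by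
  set K := σ₀ + σ₁ / δ ^ 2 + 1 with hK
  have hK1 : 1 ≤ K := by
    have : 0 ≤ σ₁ / δ ^ 2 := by positivity
    linarith
  obtain ⟨m₀, hm₀⟩ := exists_nat_ge ((40 * K ^ 2 * (1 + L) / ε) ^ 2)
  set m := m₀ + 1 with hm
  have hm1 : 1 ≤ m := by lia
  have hmsqrt : 40 * K ^ 2 * (1 + L) / ε ≤ Real.sqrt m := by
    refine Real.le_sqrt_of_sq_le (hm₀.trans ?_)
    rw [hm]
    push_cast
    linarith
  set q : ℕ → Ω → ℝ := fun n ω => rmspropStep ε (fun j => V j ω) n with hq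
  have hθ_rec' : ∀ n, 1 ≤ n → ∀ ω, θ (n + 1) ω = θ n ω - q n ω * G n ω := hθ_rec
  have hDc : Continuous D := by
    refine (LipschitzWith.of_dist_le_mul (K := L.toNNReal) fun s t => ?_).continuous
    rw [Real.coe_toNNReal _ hL.le]
    exact hD s t
  have hVm : ∀ n, 1 ≤ n → Measurable[ℱ n] (V n) := by
    intro n hn
    induction n, hn using Nat.le_induction with
    | base =>
      rw [show V 1 = fun ω => β * v + (1 - β) * G 1 ω ^ 2 from funext hV1]
      exact (((hG_meas 1 le_rfl).pow_const 2).const_mul _).const_add _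
    | succ n hn ih =>
      rw [show V (n + 1) = fun ω => (1 - 1 / ((n + 1 : ℕ) : ℝ)) * V n ω
        + (1 / ((n + 1 : ℕ) : ℝ)) * G (n + 1) ω ^ 2 from funext (hV_rec (n + 1) (by lia))]
      exact ((ih.mono (ℱ.mono n.le_succ) le_rfl).const_mul _).add
        (((hG_meas (n + 1) (by lia)).pow_const 2).const_mul _)
  have hqm : ∀ n, 1 ≤ n → Measurable[ℱ n] (q n) := fun n hn =>
    measurable_const.div ((Real.continuous_sqrt.measurable.comp (hVm n hn)).add_const ε)
  set c := 1 / Real.sqrt (1 - β) with hc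
  have hθ_bdd : ∀ n ω, |θ (n + 1) ω| ≤ |θ₁| + n * c := by
    intro n ω
    induction n with
    | zero => simp [hθ_init]
    | succ n ih =>
      rw [hθ_rec' (n + 1) (by lia)]
      refine (abs_sub _ _).trans ?_
      have h1 : |q (n + 1) ω * G (n + 1) ω| ≤ c := by
        rw [abs_mul, abs_of_pos (rmspropStep_pos hε (by lia)), mul_comm]
        exact abs_mul_rmspropStep_le (G := fun j => G j ω) hβ hv hε (hV1 ω)
          (fun n hn => hV_rec n hn ω) n
      push_cast
      linarith
  have hproc : AdaptiveStepRecursion P (shiftFiltration ℱ m) D L (max R 1) δ σ₀ σ₁ K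
      (fun k => (ε⁻¹) ^ 3 * ((k + 1 : ℕ) : ℝ) ^ (-(3 / 2) : ℝ))
      (fun k => θ (m + k + 1)) (fun k => q (m + k)) (fun k => G (m + k + 1)) :=
    { L_nonneg := hL.le
      one_le_R := le_max_right _ _
      δ_pos := hδ
      σ₀_nonneg := hσ₀
      σ₁_nonneg := hσ₁
      one_le_K := hK1
      noise_le := fun t ht => by
        have h1 : δ ^ 2 ≤ t ^ 2 := by
          rw [← sq_abs t]
          exact pow_le_pow_left₀ hδ.le ht 2
        have h2 : σ₁ ≤ σ₁ / δ ^ 2 * t ^ 2 := by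
          rw [div_mul_eq_mul_div, le_div_iff₀ (by positivity)]
          gcongr
        rw [hK]
        nlinarith [sq_nonneg t]
      lipschitz := hD
      le_abs_of_le := fun t ht => (hflat t ((le_max_left _ _).trans ht)).le
      mul_nonneg_of_le := fun t ht => by
        rcases le_total 0 t with h0 | h0
        · refine mul_nonneg h0 (deriv_pos_of_nonneg_of_lt_abs hφ hDc hφ0 hδ
            (a := max R 1) (fun s hs => hflat s ?_) (by rwa [abs_of_nonneg h0] at ht)).le
          exact (le_max_left _ _).trans (hs.trans (le_abs_self s))
        · refine mul_nonneg_of_nonpos_of_nonpos h0 (deriv_neg_of_nonneg_of_lt_abs hφ hDc hφ0 hδ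
            (a := -max R 1) (fun s hs => hflat s ?_)
            (by rw [abs_of_nonpos h0] at ht; linarith)).le
          exact (le_max_left _ _).trans ((by linarith : max R 1 ≤ -s).trans (neg_le_abs s))
      measurable_x := fun k => hθ_meas (m + k + 1) (by lia)
      measurable_p := fun k => hqm (m + k) (by lia)
      memLp_G := fun k => hG_memLp (m + k + 1) (by lia)
      bdd_zero := ⟨_, hθ_bdd m⟩
      step := fun k ω => hθ_rec' (m + k + 1) (by lia) ω
      p_pos := fun k ω => rmspropStep_pos hε (by lia)
      p_anti := fun k ω => rmspropStep_succ_le (G := fun j => G j ω) hε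
        (fun n hn => hV_rec n hn ω) (by lia)
      abs_step_le := fun k ω => abs_mul_rmspropStep_succ_le (G := fun j => G j ω) hβ hv hε
        (hV1 ω) (fun n hn => hV_rec n hn ω) (by lia)
      p_small := fun k ω => by
        have h1 : q (m + k) ω ≤ 1 / Real.sqrt ((m + k : ℕ) : ℝ) / ε := rmspropStep_le hε _
        have h2 : Real.sqrt m ≤ Real.sqrt ((m + k : ℕ) : ℝ) :=
          Real.sqrt_le_sqrt (by push_cast; linarith [Nat.cast_nonneg (α := ℝ) k])
        have h3 : 0 < Real.sqrt m := Real.sqrt_pos.2 (by exact_mod_cast hm1)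
        calc 40 * K ^ 2 * (1 + L) * q (m + k) ω
            ≤ 40 * K ^ 2 * (1 + L) * (1 / Real.sqrt ((m + k : ℕ) : ℝ) / ε) := by gcongr
          _ = 40 * K ^ 2 * (1 + L) / ε / Real.sqrt ((m + k : ℕ) : ℝ) := by ring
          _ ≤ 1 := div_le_one_of_le₀ (hmsqrt.trans h2) (Real.sqrt_nonneg _)
      p_cube_le := fun k ω => rmspropStep_cube_le hε hm1 k
      summable_b := by
        refine Summable.mul_left _ ?_
        exact (summable_nat_add_iff 1).2 (Real.summable_nat_rpow.2 (by norm_num))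
      condExp_G := fun k => hG_unbiased (m + k + 1) (by lia)
      condExp_G_sq := fun k => hG_var (m + k + 1) (by lia) }
  have hfin := hproc.lintegral_iSup_sq_lt_top
  set C := φ 0 + |D 0| + L with hC
  have hC0 : 0 ≤ C := by have := hφ0 0; positivity
  have hquad : ∀ t, φ t ≤ C + C * t ^ 2 := fun t => by
    have := le_quadratic_of_hasDerivAt hL.le hφ hD hφ0 t
    linarith
  set B := |θ₁| + m * c with hB
  have hc0 : 0 ≤ c := by positivity
  have hbound : ∀ ω, ⨆ n : ℕ, ENNReal.ofReal (φ (θ (n + 1) ω)) ≤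
      ENNReal.ofReal (C + C * B ^ 2)
        + ENNReal.ofReal C * ⨆ k, ENNReal.ofReal (θ (m + k + 1) ω ^ 2) := by
    intro ω
    refine iSup_le fun n => ?_
    rcases le_total n m with hnm | hnm
    · refine le_trans (ENNReal.ofReal_le_ofReal ((hquad _).trans ?_)) le_self_add
      have h1 : |θ (n + 1) ω| ≤ B := (hθ_bdd n ω).trans (by rw [hB]; gcongr)
      rw [← sq_abs]
      gcongr
    · obtain ⟨k, rfl⟩ := Nat.exists_eq_add_of_le hnm
      refine (ENNReal.ofReal_le_ofReal (hquad _)).trans ?_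
      rw [ENNReal.ofReal_add hC0 (by positivity), ENNReal.ofReal_mul hC0]
      gcongr
      · have : 0 ≤ C * B ^ 2 := by positivity
        linarith
      · exact le_iSup (fun k => ENNReal.ofReal (θ (m + k + 1) ω ^ 2)) k
  calc _ ≤ ∫⁻ ω, (ENNReal.ofReal (C + C * B ^ 2)
        + ENNReal.ofReal C * ⨆ k, ENNReal.ofReal (θ (m + k + 1) ω ^ 2)) ∂P :=
        lintegral_mono hbound
    _ = ENNReal.ofReal (C + C * B ^ 2)
        + ENNReal.ofReal C * ∫⁻ ω, ⨆ k, ENNReal.ofReal (θ (m + k + 1) ω ^ 2) ∂P := by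
        rw [lintegral_add_left measurable_const, lintegral_const_mul' _ _ ENNReal.ofReal_ne_top]
        simp
    _ < ⊤ := ENNReal.add_lt_top.2
        ⟨ENNReal.ofReal_lt_top, ENNReal.mul_lt_top ENNReal.ofReal_lt_top hfin⟩

/-- Stability of function values for RMSProp (Theorem 6.4):
`E[sup_{n≥1} g(θ_n)] < +∞`. -/
theorem rmsprop_function_value_stability
    {d : ℕ} {Ω : Type*} {m0 : MeasurableSpace Ω} (P : Measure Ω) [IsProbabilityMeasure P]
    (ℱ : Filtration ℕ m0)
    (g : EuclideanSpace ℝ (Fin d) → ℝ)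
    (L σ₀ σ₁ v ε β₁ : ℝ)
    (hL : 0 < L) (hσ₀ : 0 ≤ σ₀) (hσ₁ : 0 ≤ σ₁) (hv : 0 < v) (hε : 0 < ε)
    (hβ₁ : β₁ ∈ Set.Ioo (0 : ℝ) 1)
    (hg_diff : ContDiff ℝ 1 g)
    (hg_nonneg : ∀ x, 0 ≤ g x)
    (hg_smooth : ∀ x y, ‖gradient g x - gradient g y‖ ≤ L * ‖x - y‖)
    (θ₁ : EuclideanSpace ℝ (Fin d))
    (G θ : ℕ → Ω → EuclideanSpace ℝ (Fin d))
    (V : ℕ → Ω → Fin d → ℝ)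
    (hG_meas : ∀ n, 1 ≤ n → StronglyMeasurable[ℱ n] (G n))
    (hG_int : ∀ n, 1 ≤ n → Integrable (G n) P)
    (hG_sq_int : ∀ n, 1 ≤ n → Integrable (fun ω => ‖G n ω‖ ^ 2) P)
    (hθ_adapted : ∀ n, 1 ≤ n → StronglyMeasurable[ℱ (n - 1)] (θ n))
    (hθ_init : ∀ ω, θ 1 ω = θ₁)
    (hV0 : ∀ ω i, V 0 ω i = v)
    (hV1 : ∀ ω i, V 1 ω i = β₁ * v + (1 - β₁) * G 1 ω i ^ 2)
    (hV_rec : ∀ n : ℕ, 2 ≤ n → ∀ ω i,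
      V n ω i = (1 - 1 / (n : ℝ)) * V (n - 1) ω i + (1 / (n : ℝ)) * G n ω i ^ 2)
    (hθ_rec : ∀ n : ℕ, 1 ≤ n → ∀ ω (i : Fin d),
      θ (n + 1) ω i = θ n ω i
        - (1 / Real.sqrt (n : ℝ)) / (Real.sqrt (V n ω i) + ε) * G n ω i)
    (hG_unbiased : ∀ n, 1 ≤ n →
      P[G n | ℱ (n - 1)] =ᵐ[P] fun ω => gradient g (θ n ω))
    (hG_var : ∀ n, 1 ≤ n → ∀ i : Fin d, ∀ᵐ ω ∂P,
      (P[fun ω => G n ω i ^ 2 | ℱ (n - 1)]) ω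
        ≤ σ₀ * gradient g (θ n ω) i ^ 2 + σ₁)
    (δt : ℝ) (hδt : 0 < δt)
    (hflat : ∀ i : Fin d, ∀ᶠ x in Bornology.cobounded (EuclideanSpace ℝ (Fin d)),
      δt < |gradient g x i|) :
    ∫⁻ ω, (⨆ n : ℕ, ENNReal.ofReal (g (θ (n + 1) ω))) ∂P < ⊤ := by
  match d with
  | 0 =>
    have hconst : ∀ n ω, θ (n + 1) ω = θ₁ := fun n ω => Subsingleton.elim _ _
    simp [hconst]
  | 1 =>
    obtain ⟨R, -, hR⟩ := hasBasis_cobounded_norm.eventually_iff.1 (hflat 0)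
    set e : EuclideanSpace ℝ (Fin 1) := EuclideanSpace.single 0 (1 : ℝ) with he
    have hrep : ∀ y : EuclideanSpace ℝ (Fin 1), y 0 • e = y := fun y => by
      ext i
      rw [Subsingleton.elim i 0]
      simp [he]
    have hnorm : ∀ t : ℝ, ‖t • e‖ = |t| := fun t => by simp [he, norm_smul]
    have hmain := rmsprop_stability_real (P := P) ℱ (φ := fun t => g (t • e))
      (D := fun t => gradient g (t • e) 0) (R := R) (θ₁ := θ₁ 0) (G := fun n ω => G n ω 0)
      (θ := fun n ω => θ n ω 0) (V := fun n ω => V n ω 0) hL hσ₀ hσ₁ hv hε hβ₁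
      (fun t => by simpa using hasDerivAt_comp_line hg_diff 0 0 t)
      (fun t => hg_nonneg _)
      (fun s t => by
        have h1 := hg_smooth (s • e) (t • e)
        rw [← sub_smul, hnorm] at h1
        exact (PiLp.norm_apply_le (gradient g (s • e) - gradient g (t • e)) 0).trans h1)
      hδt (fun t ht => hR (by rw [Set.mem_ofPred_eq, hnorm]; exact ht))
      (fun n hn => ((EuclideanSpace.proj (𝕜 := ℝ) (0 : Fin 1)).continuous.comp_stronglyMeasurable
        (hG_meas n hn)).measurable)
      (fun n hn => by
        have hm : AEStronglyMeasurable (fun ω => G n ω 0) P :=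
          (EuclideanSpace.proj (𝕜 := ℝ) (0 : Fin 1)).continuous.comp_aestronglyMeasurable
            (hG_int n hn).aestronglyMeasurable
        rw [memLp_two_iff_integrable_sq hm]
        refine (hG_sq_int n hn).congr (ae_of_all _ fun ω => ?_)
        simp [EuclideanSpace.norm_sq_eq])
      (fun n hn => ((EuclideanSpace.proj (𝕜 := ℝ) (0 : Fin 1)).continuous.comp_stronglyMeasurable
        (hθ_adapted n hn)).measurable)
      (fun ω => by rw [hθ_init]) (fun ω => hV1 ω 0) (fun n hn ω => hV_rec n hn ω 0)
      (fun n hn ω => hθ_rec n hn ω 0)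
      (fun n hn => by
        have h1 := (EuclideanSpace.proj (𝕜 := ℝ) (0 : Fin 1)).comp_condExp_comm
          (hG_int n hn) (m := ℱ (n - 1))
        filter_upwards [h1, hG_unbiased n hn] with ω h2 h3
        rw [hrep]
        refine h2.symm.trans ?_
        simp [h3])
      (fun n hn => by
        filter_upwards [hG_var n hn 0] with ω h1
        rw [hrep]
        exact h1)
    simpa only [hrep] using hmain
  | d + 2 =>
    exact (false_of_forall_lt_abs_gradient hL hg_diff hg_nonneg hg_smooth hδt
      (i := 0) (j := 1) (by simp) (hflat 0)).elim
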